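/- arXiv:1402.4422 — 17 statements merged into one kernel-verified Lean document; each statement's English description precedes it below -/
import Mathlib

section
/- Let p be a prime, let f_1, f_2, …, f_n be polynomials in m variables over the field 𝔽_p, each with zero constant term, and let Q_1, …, Q_n ⊆ 𝔽_p be sets with 0 ∈ Q_i for every i. If m > Σ_{i=1}^n deg(f_i)·|𝔽_p \ Q_i|, then there exists a vector x ∈ {0,1}^m with x ≠ 0 such that f_i(x) ∈ Q_i for every i = 1, …, n. -/
open MvPolynomial in
/-- A polynomial of degree less than the number of variables which does not vanish at the origin
does not vanish at some other vertex of the cube `{0, 1}^σ`. -/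
theorem MvPolynomial.exists_zero_one_ne_zero_eval_ne_zero {R σ : Type*} [CommRing R] [IsDomain R]
    [Fintype σ] (g : MvPolynomial σ R) (hdeg : g.totalDegree < Fintype.card σ)
    (hg : eval 0 g ≠ 0) :
    ∃ x : σ → R, (∀ j, x j = 0 ∨ x j = 1) ∧ x ≠ 0 ∧ eval x g ≠ 0 := by
  classical
  let : LinearOrder σ := WellOrderingRel.isWellOrder.linearOrder
  let c : R := eval 0 g * (-1) ^ Fintype.card σ
  have hc : c ≠ 0 := mul_ne_zero hg (pow_ne_zero _ (neg_ne_zero.mpr one_ne_zero))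
  let t : σ →₀ ℕ := ∑ i, Finsupp.single i 1
  have ht (i : σ) : t i = 1 := by simp [t, Finsupp.finsetSum_apply, Finsupp.single_apply]
  have htdeg : t.degree = Fintype.card σ := by simp [t]
  let D : MvPolynomial σ R := ∏ i, (X i - C 1)
  have hDmonic : MonomialOrder.degLex.Monic D :=
    MonomialOrder.Monic.prod fun i _ ↦ MonomialOrder.degLex.monic_X_sub_C i 1
  have hDdeg : MonomialOrder.degLex.degree D = t := by
    simp only [D, t]
    rw [MonomialOrder.degree_prod_of_regular]
    · exact Finset.sum_congr rfl fun i _ ↦ MonomialOrder.degLex.degree_X_sub_C i 1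
    · intro i _
      rw [MonomialOrder.degLex.monic_X_sub_C]
      exact isRegular_one
  have hDcoeff : D.coeff t = 1 := by rw [← hDdeg]; exact hDmonic
  have hDtotal : D.totalDegree ≤ Fintype.card σ := by
    refine (totalDegree_finsetProd _ _).trans ?_
    refine (Finset.sum_le_card_nsmul _ _ 1 fun i _ ↦ ?_).trans (by simp)
    exact (totalDegree_sub_C_le _ _).trans (totalDegree_X i).le
  have hgcoeff : g.coeff t = 0 := by
    refine coeff_eq_zero_of_totalDegree_lt ?_
    rw [← Finsupp.degree_apply, htdeg]
    exact hdeg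
  have hPcoeff : (g - C c * D).coeff t ≠ 0 := by
    simpa [hgcoeff, hDcoeff] using hc
  have hPtotal : (g - C c * D).totalDegree = t.degree := by
    refine le_antisymm ?_ (le_totalDegree (mem_support_iff.mpr hPcoeff))
    rw [htdeg]
    refine (totalDegree_sub _ _).trans (max_le hdeg.le ((totalDegree_mul _ _).trans ?_))
    simpa using hDtotal
  obtain ⟨x, hx, hPx⟩ := combinatorial_nullstellensatz_exists_eval_nonzero (g - C c * D) t
    hPcoeff hPtotal (fun _ ↦ {0, 1}) fun i ↦ by simp [ht]
  have hx01 : ∀ j, x j = 0 ∨ x j = 1 := by simpa using hx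
  have hx0 : x ≠ 0 := by
    rintro rfl
    apply hPx
    simp [c, D, mul_assoc, ← mul_pow]
  refine ⟨x, hx01, hx0, ?_⟩
  obtain ⟨j, hj⟩ := Function.ne_iff.mp hx0
  have hDx : eval x D = 0 := by
    rw [eval_prod]
    exact Finset.prod_eq_zero (Finset.mem_univ j) (by simp [(hx01 j).resolve_left hj])
  simpa [hDx] using hPx

/-- **Corollary of the Combinatorial Nullstellensatz over `𝔽_p`.**
If `f 1, …, f n` are `m`-variable polynomials over `𝔽_p` with zero constant
term, `Q i ⊆ 𝔽_p` contain `0`, and `m > Σᵢ deg(f i) · |𝔽_p \ Q i|`, then some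
nonzero `0`-`1` vector `x` satisfies `f i (x) ∈ Q i` for all `i`. -/
theorem combinatorial_nullstellensatz_mod_p
    (p : ℕ) (hp : p.Prime) (n m : ℕ)
    (f : Fin n → MvPolynomial (Fin m) (ZMod p))
    (hf0 : ∀ i, MvPolynomial.coeff 0 (f i) = 0)
    (Q : Fin n → Set (ZMod p)) (hQ0 : ∀ i, (0 : ZMod p) ∈ Q i)
    (hm : ∑ i, (f i).totalDegree * ((Q i)ᶜ.ncard) < m) :
    ∃ x : Fin m → ZMod p, (∀ j, x j = 0 ∨ x j = 1) ∧ x ≠ 0 ∧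
      ∀ i, MvPolynomial.eval x (f i) ∈ Q i := by
  classical
  have : Fact p.Prime := ⟨hp⟩
  let B (i : Fin n) : Finset (ZMod p) := (Set.toFinite (Q i)ᶜ).toFinset
  have hB (i : Fin n) (q : ZMod p) : q ∈ B i ↔ q ∉ Q i := by simp [B]
  have hBcard (i : Fin n) : (B i).card = (Q i)ᶜ.ncard :=
    (Set.ncard_eq_toFinset_card _ _).symm
  let g : MvPolynomial (Fin m) (ZMod p) := ∏ i, ∏ q ∈ B i, (f i - MvPolynomial.C q)
  have hgeval (x : Fin m → ZMod p) :
      MvPolynomial.eval x g ≠ 0 ↔ ∀ i, MvPolynomial.eval x (f i) ∈ Q i := by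
    simp only [g, MvPolynomial.eval_prod, Finset.prod_ne_zero_iff, Finset.mem_univ, true_imp_iff,
      map_sub, MvPolynomial.eval_C, sub_ne_zero, hB]
    exact forall_congr' fun i ↦ ⟨fun h ↦ by_contra fun hq ↦ h _ hq rfl,
      fun h q hq hfq ↦ hq (hfq ▸ h)⟩
  have hgdeg : g.totalDegree < Fintype.card (Fin m) := by
    rw [Fintype.card_fin]
    refine lt_of_le_of_lt ?_ hm
    refine (MvPolynomial.totalDegree_finsetProd _ _).trans (Finset.sum_le_sum fun i _ ↦ ?_)
    refine (MvPolynomial.totalDegree_finsetProd _ _).trans ?_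
    refine (Finset.sum_le_card_nsmul _ _ (f i).totalDegree fun q _ ↦
      MvPolynomial.totalDegree_sub_C_le _ _).trans ?_
    rw [hBcard, smul_eq_mul, mul_comm]
  have hg0 : MvPolynomial.eval 0 g ≠ 0 := (hgeval 0).mpr fun i ↦ by
    rw [MvPolynomial.eval_zero, MvPolynomial.constantCoeff_eq, hf0]
    exact hQ0 i
  obtain ⟨x, hx01, hx0, hgx⟩ := g.exists_zero_one_ne_zero_eval_ne_zero hgdeg hg0
  exact ⟨x, hx01, hx0, (hgeval x).mp hgx⟩
end

section
/- Olson's theorem (stated as an equality of thresholds): Let p be a prime and let d_1 ≥ d_2 ≥ … ≥ d_n ≥ 1 be integers. (Upper bound) For every m > Σ_{i=1}^n (p^{d_i} − 1) and all integers a_{ij} (i = 1,…,n, j = 1,…,m), there exists a nonempty subset J ⊆ {1,…,m} such that Σ_{j∈J} a_{ij} ≡ 0 (mod p^{d_i}) for every i. (Tightness) For m = Σ_{i=1}^n (p^{d_i} − 1) there exist integers a_{ij} (i = 1,…,n, j = 1,…,m) such that no nonempty subset J ⊆ {1,…,m} satisfies Σ_{j∈J} a_{ij} ≡ 0 (mod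 p^{d_i}) for every i. -/
open Finset in
/-- A product of more than `∑ i, (k i - 1)` elements of the ideal generated by elements `y i`
with `y i ^ k i = 0` vanishes. -/
theorem prod_eq_zero_of_mem_span_range {ι κ A : Type*} [Fintype ι] [Fintype κ] [CommRing A]
    {y : ι → A} {k : ι → ℕ} (hy : ∀ i, y i ^ k i = 0)
    (hcard : ∑ i, (k i - 1) < Fintype.card κ) {z : κ → A}
    (hz : ∀ j, z j ∈ Ideal.span (Set.range y)) : ∏ j, z j = 0 := by
  classical
  choose c hc using fun j ↦ Ideal.mem_span_range_iff_exists_fun.1 (hz j)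
  simp_rw [← hc, Finset.prod_univ_sum]
  refine Finset.sum_eq_zero fun f _ ↦ ?_
  obtain ⟨i, hi⟩ : ∃ i, k i - 1 < #{j | f j = i} := by
    by_contra! h
    refine hcard.not_ge ?_
    rw [← Finset.card_univ, Finset.card_eq_sum_card_fiberwise (f := f) (t := univ) (by simp)]
    exact Finset.sum_le_sum fun i _ ↦ h i
  rw [Finset.prod_mul_distrib, ← Finset.prod_fiberwise univ f (fun j ↦ y (f j))]
  have h0 : ∏ j with f j = i, y (f j) = 0 := by
    rw [Finset.prod_congr rfl fun j hj ↦ by rw [(Finset.mem_filter.1 hj).2],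
      Finset.prod_const]
    exact pow_eq_zero_of_le (by lia) (hy i)
  rw [Finset.prod_eq_zero (mem_univ i) h0, mul_zero]

/-- In the group algebra of `∏ i, ZMod (k i)`, every `1 - x ^ g` lies in the ideal generated by
the elements `1 - x i`, where the `x i` are the standard generators. -/
theorem one_sub_single_mem_span {ι R : Type*} [Fintype ι] [DecidableEq ι] [CommRing R]
    (k : ι → ℕ) [∀ i, NeZero (k i)] (g : ∀ i, ZMod (k i)) :
    (1 - AddMonoidAlgebra.single g 1 : AddMonoidAlgebra R (∀ i, ZMod (k i))) ∈
      Ideal.span (Set.range fun i ↦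
        (1 - AddMonoidAlgebra.single (Pi.single i 1) 1 :
          AddMonoidAlgebra R (∀ i, ZMod (k i)))) := by
  have hg : (AddMonoidAlgebra.single g 1 : AddMonoidAlgebra R (∀ i, ZMod (k i))) =
      ∏ i, AddMonoidAlgebra.single (Pi.single i 1) 1 ^ (g i).val := by
    have h : g = ∑ i, (g i).val • Pi.single i (1 : ZMod (k i)) := by
      conv_lhs => rw [← Finset.univ_sum_single g]
      refine Finset.sum_congr rfl fun i _ ↦ ?_
      rw [← Pi.single_smul]
      simp
    simp_rw [AddMonoidAlgebra.single_pow, one_pow]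
    conv_lhs => rw [h]
    simp
  rw [← Ideal.Quotient.eq, hg, map_one, map_prod]
  refine (Finset.prod_eq_one fun i _ ↦ ?_).symm
  have hi := Ideal.Quotient.eq.2 (Ideal.subset_span (Set.mem_range_self (f := fun i ↦
    (1 - AddMonoidAlgebra.single (Pi.single i 1) 1 :
      AddMonoidAlgebra R (∀ i, ZMod (k i)))) i))
  rw [map_pow, ← hi, map_one, one_pow]

/-- Upper bound for the Davenport constant of `∏ i, ZMod (p ^ d i)`. -/
theorem exists_nonempty_sum_eq_zero {ι κ : Type*} [Fintype ι] [Fintype κ] {p : ℕ} (hp : p.Prime)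
    (d : ι → ℕ) (hcard : ∑ i, (p ^ d i - 1) < Fintype.card κ)
    (g : κ → ∀ i, ZMod (p ^ d i)) :
    ∃ J : Finset κ, J.Nonempty ∧ ∑ j ∈ J, g j = 0 := by
  classical
  have : Fact p.Prime := ⟨hp⟩
  have : ∀ i, NeZero (p ^ d i) := fun i ↦ ⟨pow_ne_zero _ hp.ne_zero⟩
  have : CharP (AddMonoidAlgebra (ZMod p) (∀ i, ZMod (p ^ d i))) p :=
    charP_of_injective_algebraMap (FaithfulSMul.algebraMap_injective (ZMod p) _) p
  have hprod : ∏ j, (1 - AddMonoidAlgebra.single (g j) 1 :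
      AddMonoidAlgebra (ZMod p) (∀ i, ZMod (p ^ d i))) = 0 := by
    refine prod_eq_zero_of_mem_span_range (fun i ↦ ?_) hcard
      fun j ↦ one_sub_single_mem_span _ (g j)
    rw [sub_pow_char_pow, one_pow, AddMonoidAlgebra.single_pow, one_pow, ← Pi.single_smul]
    simp [AddMonoidAlgebra.one_def]
  by_contra! h
  have hterm : ∀ J : Finset κ, (∏ j ∈ J, -(AddMonoidAlgebra.single (g j) 1 :
      AddMonoidAlgebra (ZMod p) (∀ i, ZMod (p ^ d i)))) =
      AddMonoidAlgebra.single (∑ j ∈ J, g j) ((-1) ^ J.card) := by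
    intro J
    induction J using Finset.induction_on with
    | empty => simp [AddMonoidAlgebra.one_def]
    | insert j J hj ih =>
      rw [Finset.prod_insert hj, ih, Finset.sum_insert hj, Finset.card_insert_of_notMem hj,
        ← AddMonoidAlgebra.single_neg, AddMonoidAlgebra.single_mul_single, pow_succ']
  simp_rw [sub_eq_add_neg, Finset.prod_one_add, hterm] at hprod
  have h0 := congrArg (fun x : AddMonoidAlgebra (ZMod p) (∀ i, ZMod (p ^ d i)) ↦ x.coeff 0) hprod
  simp only [AddMonoidAlgebra.coeff_sum, Finsupp.finsetSum_apply] at h0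
  rw [Finset.sum_eq_single ∅] at h0
  · simp at h0
  · intro J _ hJ
    simp [h J (Finset.nonempty_iff_ne_empty.2 hJ)]
  · simp

open Finset in
/-- Lower bound for the Davenport constant of `∏ i, ZMod (k i)`: repeat each standard generator
`k i - 1` times. -/
theorem exists_forall_nonempty_not_dvd_sum {n : ℕ} (k : Fin n → ℕ) :
    ∃ a : Fin n → Fin (∑ i, (k i - 1)) → ℤ,
      ∀ J : Finset (Fin (∑ i, (k i - 1))), J.Nonempty →
        ¬ ∀ i, (k i : ℤ) ∣ ∑ j ∈ J, a i j := by
  let e := finSigmaFinEquiv (n := fun i ↦ k i - 1)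
  refine ⟨fun i j ↦ if (e.symm j).1 = i then 1 else 0, fun J ⟨j, hj⟩ h ↦ ?_⟩
  set i := (e.symm j).1
  have hdvd := h i
  rw [Finset.sum_boole, Int.natCast_dvd_natCast] at hdvd
  have hpos : 0 < #{l ∈ J | (e.symm l).1 = i} :=
    Finset.card_pos.2 ⟨j, Finset.mem_filter.2 ⟨hj, rfl⟩⟩
  have hle : #{l ∈ J | (e.symm l).1 = i} ≤ k i - 1 := by
    calc #{l ∈ J | (e.symm l).1 = i}
        ≤ #(univ.image fun t : Fin (k i - 1) ↦ e ⟨i, t⟩) := by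
          refine Finset.card_le_card fun l hl ↦ ?_
          obtain ⟨x, rfl⟩ := e.surjective l
          obtain ⟨i', t⟩ := x
          obtain rfl : i' = i := by simpa using (Finset.mem_filter.1 hl).2
          exact Finset.mem_image_of_mem _ (mem_univ t)
      _ ≤ k i - 1 := Finset.card_image_le.trans (by simp)
  have := Nat.le_of_dvd hpos hdvd
  lia


/-- **Olson's theorem**, stated as an equality of thresholds.
For `d 1 ≥ d 2 ≥ … ≥ d n ≥ 1`:
(upper bound) whenever `m > Σᵢ (p ^ d i − 1)`, every integer array `a` admits a
nonempty `J ⊆ {1,…,m}` with `p ^ d i ∣ Σ_{j ∈ J} a i j` for all `i`;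
(tightness) for `m = Σᵢ (p ^ d i − 1)` some integer array admits no such `J`. -/
theorem olson_theorem (p n : ℕ) (hp : p.Prime)
    (d : Fin n → ℕ) (hd1 : ∀ i, 1 ≤ d i)
    (hmono : ∀ i j : Fin n, i ≤ j → d j ≤ d i) :
    (∀ m : ℕ, (∑ i, (p ^ d i - 1)) < m → ∀ a : Fin n → Fin m → ℤ,
      ∃ J : Finset (Fin m), J.Nonempty ∧
        ∀ i, (p : ℤ) ^ d i ∣ ∑ j ∈ J, a i j) ∧
    (∃ a : Fin n → Fin (∑ i, (p ^ d i - 1)) → ℤ,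
      ∀ J : Finset (Fin (∑ i, (p ^ d i - 1))), J.Nonempty →
        ¬ ∀ i, (p : ℤ) ^ d i ∣ ∑ j ∈ J, a i j) := by
  refine ⟨fun m hm a ↦ ?_, ?_⟩
  · obtain ⟨J, hJ, hsum⟩ := exists_nonempty_sum_eq_zero hp d (κ := Fin m) (by simpa using hm)
      (fun j i ↦ (a i j : ZMod (p ^ d i)))
    refine ⟨J, hJ, fun i ↦ ?_⟩
    have h := congrFun hsum i
    rw [Finset.sum_apply, Pi.zero_apply, ← Int.cast_sum, ZMod.intCast_zmod_eq_zero_iff_dvd] at h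
    exact_mod_cast h
  · simpa using exists_forall_nonempty_not_dvd_sum fun i ↦ p ^ d i
end

section
/- Theorem of Alon, Friedland and Kalai: Let p be a prime, let d_1 ≥ d_2 ≥ … ≥ d_n ≥ 1 be integers, and for each i let Q_i ⊆ ℤ/p^{d_i}ℤ be a set containing 0. If m > Σ_{i=1}^n (p^{d_i} − card_p(Q_i)), then for all integers a_{ij} (i = 1,…,n, j = 1,…,m) there exists a nonempty subset J ⊆ {1,…,m} such that for every i, the residue of Σ_{j∈J} a_{ij} modulo p^{d_i} belongs to Q_i. -/
/-- `card_p Q` is the number of distinct residues modulo `p` among the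
elements of `Q ⊆ ℤ/Nℤ` (elements are represented by their values in `[0, N)`). -/
def cardp (p : ℕ) {N : ℕ} (Q : Finset (ZMod N)) : ℕ :=
  (Q.image fun q => ZMod.val q % p).card

/-- The `p`-adic valuation on `ℤ/p^dℤ`, with value `d` at zero. -/
def zmodVal (p d : ℕ) (t : ZMod (p ^ d)) : ℕ :=
  if t = 0 then d else padicValNat p t.val

section zmodVal

open Finset

variable {p d : ℕ} [Fact p.Prime]

lemma pow_dvd_iff_pow_dvd_val (y : ℤ) {k : ℕ} (hk : k ≤ d) :
    (p : ℤ) ^ k ∣ y ↔ p ^ k ∣ (y : ZMod (p ^ d)).val := by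
  have h : (p : ℤ) ^ k ∣ ((p ^ d : ℕ) : ℤ) := by
    push_cast
    exact pow_dvd_pow _ hk
  rw [← Int.natCast_dvd_natCast, ZMod.val_intCast, Nat.cast_pow, EuclideanDomain.dvd_mod_iff h]

lemma zmodVal_lt {t : ZMod (p ^ d)} (ht : t ≠ 0) : zmodVal p d t < d := by
  have hv : t.val ≠ 0 := (ZMod.val_ne_zero t).2 ht
  rw [zmodVal, if_neg ht]
  by_contra! h
  have := Nat.le_of_dvd (Nat.pos_of_ne_zero hv) ((padicValNat_dvd_iff_le hv).2 h)
  exact absurd (ZMod.val_lt t) (not_lt.2 this)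

lemma pow_zmodVal_dvd (y : ℤ) : (p : ℤ) ^ zmodVal p d y ∣ y := by
  by_cases hy : (y : ZMod (p ^ d)) = 0
  · rw [zmodVal, if_pos hy, pow_dvd_iff_pow_dvd_val y le_rfl, hy]
    simp
  · rw [pow_dvd_iff_pow_dvd_val y (zmodVal_lt hy).le, zmodVal, if_neg hy]
    exact pow_padicValNat_dvd

lemma emultiplicity_eq_zmodVal {y : ℤ} (hy : (y : ZMod (p ^ d)) ≠ 0) :
    emultiplicity (p : ℤ) y = zmodVal p d y := by
  refine emultiplicity_eq_coe.2 ⟨pow_zmodVal_dvd y, ?_⟩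
  rw [pow_dvd_iff_pow_dvd_val y (zmodVal_lt hy), zmodVal, if_neg hy]
  exact pow_succ_padicValNat_not_dvd ((ZMod.val_ne_zero _).2 hy)

lemma zmodVal_sub_eq_zero (hd : d ≠ 0) {s t : ZMod (p ^ d)} (h : s.val % p ≠ t.val % p) :
    zmodVal p d (s - t) = 0 := by
  have hne : s - t ≠ 0 := fun h0 => h (by rw [sub_eq_zero.1 h0])
  have hdvd : p ∣ p ^ d := dvd_pow_self p hd
  rw [zmodVal, if_neg hne]
  refine padicValNat.eq_zero_of_not_dvd fun hp => h ?_
  have key : ZMod.castHom hdvd (ZMod p) (s - t) = 0 := by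
    rwa [ZMod.castHom_apply, ZMod.cast_eq_val, ZMod.natCast_eq_zero_iff]
  rw [map_sub, sub_eq_zero, ZMod.castHom_apply, ZMod.castHom_apply, ZMod.cast_eq_val,
    ZMod.cast_eq_val, ZMod.natCast_eq_natCast_iff'] at key
  exact key

lemma sum_zmodVal_sub (x : ZMod (p ^ d)) :
    ∑ r, zmodVal p d (x - r) = ∑ r, zmodVal p d r :=
  (Equiv.subLeft x).sum_comp (zmodVal p d)

/-- For a set `S` with pairwise distinct residues modulo `p`, only one term `x - q` can have
positive valuation. -/
lemma sum_zmodVal_sub_lt (hd : d ≠ 0) {S : Finset (ZMod (p ^ d))}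
    (hS : Set.InjOn (fun q : ZMod (p ^ d) => q.val % p) S) {x : ZMod (p ^ d)} (hx : x ∉ S) :
    ∑ q ∈ S, zmodVal p d (x - q) < d := by
  by_cases h : ∃ q ∈ S, x.val % p = q.val % p
  · obtain ⟨q, hq, hxq⟩ := h
    rw [sum_eq_single_of_mem q hq fun b hb hbq => zmodVal_sub_eq_zero hd fun hxb =>
      hbq (hS hb hq (hxb.symm.trans hxq))]
    exact zmodVal_lt (sub_ne_zero.2 fun h => hx (h ▸ hq))
  · push Not at h
    rw [sum_eq_zero fun q hq => zmodVal_sub_eq_zero hd (h q hq)]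
    exact Nat.pos_of_ne_zero hd

lemma sum_zmodVal_sub_mem (hd : d ≠ 0) {S : Finset (ZMod (p ^ d))}
    (hS : Set.InjOn (fun q : ZMod (p ^ d) => q.val % p) S) {x : ZMod (p ^ d)} (hx : x ∈ S) :
    ∑ q ∈ S, zmodVal p d (x - q) = d := by
  rw [sum_eq_single_of_mem x hx fun b hb hbx => zmodVal_sub_eq_zero hd fun hxb =>
      hbx (hS hb hx hxb.symm)]
  simp [zmodVal]

lemma pow_sum_zmodVal_dvd (R : Finset (ZMod (p ^ d))) (x : ℤ) :
    (p : ℤ) ^ (∑ r ∈ R, zmodVal p d (x - r)) ∣ ∏ r ∈ R, (x - (r.val : ℤ)) := by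
  rw [← prod_pow_eq_pow_sum]
  refine prod_dvd_prod_of_dvd _ _ fun r _ => ?_
  have h := pow_zmodVal_dvd (p := p) (d := d) (x - (r.val : ℤ))
  simpa using h

lemma emultiplicity_prod_sub {R : Finset (ZMod (p ^ d))} {x : ℤ}
    (hx : (x : ZMod (p ^ d)) ∉ R) :
    emultiplicity (p : ℤ) (∏ r ∈ R, (x - (r.val : ℤ))) =
      (∑ r ∈ R, zmodVal p d (x - r) : ℕ) := by
  rw [Finset.emultiplicity_prod (Nat.prime_iff_prime_int.1 Fact.out), Nat.cast_sum]
  refine sum_congr rfl fun r hr => ?_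
  have hcast : ((x - (r.val : ℤ) : ℤ) : ZMod (p ^ d)) = x - r := by simp
  rw [← hcast]
  apply emultiplicity_eq_zmodVal
  rw [hcast]
  exact sub_ne_zero.2 fun h => hx (h ▸ hr)

/-- A product of `p ^ d - cardp p Q` integer linear factors whose `p`-adic valuation is
larger outside `Q` than at zero. -/
lemma exists_finset_emultiplicity_prod_sub (hd : d ≠ 0) {Q : Finset (ZMod (p ^ d))}
    (hQ : 0 ∈ Q) :
    ∃ (R : Finset (ZMod (p ^ d))) (v : ℕ), #R = p ^ d - cardp p Q ∧
      (∀ x : ℤ, (p : ℤ) ^ v ∣ ∏ r ∈ R, (x - (r.val : ℤ))) ∧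
      (∀ x : ℤ, (x : ZMod (p ^ d)) ∉ Q → (p : ℤ) ^ (v + 1) ∣ ∏ r ∈ R, (x - (r.val : ℤ))) ∧
      emultiplicity (p : ℤ) (∏ r ∈ R, (0 - (r.val : ℤ))) = v := by
  obtain ⟨u, h0u, huQ, himg, hinj⟩ := (Set.injOn_singleton
    (fun q : ZMod (p ^ d) => q.val % p) 0).exists_subset_injOn_subset_range_eq
      (s := (Q : Set (ZMod (p ^ d)))) (by simpa using hQ)
  obtain ⟨S, rfl⟩ : ∃ S : Finset (ZMod (p ^ d)), u = S := ⟨u.toFinite.toFinset, by simp⟩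
  have hcard : #S = cardp p Q := by
    rw [cardp, ← card_image_of_injOn hinj]
    congr 1
    exact_mod_cast himg
  have h0S : (0 : ZMod (p ^ d)) ∈ S := by simpa using h0u
  have hsum (x : ZMod (p ^ d)) : ∑ q ∈ S, zmodVal p d (x - q) +
      ∑ r ∈ Sᶜ, zmodVal p d (x - r) = ∑ r, zmodVal p d r := by
    rw [sum_add_sum_compl, sum_zmodVal_sub]
  have hmem {x : ZMod (p ^ d)} (hx : x ∈ S) :
      ∑ r ∈ Sᶜ, zmodVal p d (x - r) = ∑ r, zmodVal p d r - d := by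
    have := hsum x
    rw [sum_zmodVal_sub_mem hd hinj hx] at this
    lia
  have hle : d ≤ ∑ r, zmodVal p d r := by
    have := hsum 0
    rw [sum_zmodVal_sub_mem hd hinj h0S] at this
    lia
  have hnot {x : ZMod (p ^ d)} (hx : x ∉ S) :
      ∑ r, zmodVal p d r - d + 1 ≤ ∑ r ∈ Sᶜ, zmodVal p d (x - r) := by
    have := hsum x
    have := sum_zmodVal_sub_lt hd hinj hx
    lia
  refine ⟨Sᶜ, ∑ r, zmodVal p d r - d, ?_, fun x => ?_, fun x hx => ?_, ?_⟩
  · rw [card_compl, ZMod.card, hcard]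
  · refine (pow_dvd_pow _ ?_).trans (pow_sum_zmodVal_dvd _ x)
    by_cases hx : (x : ZMod (p ^ d)) ∈ S
    · exact (hmem hx).ge
    · exact (Nat.le_succ _).trans (hnot hx)
  · exact (pow_dvd_pow _ (hnot fun h => hx (huQ h))).trans (pow_sum_zmodVal_dvd _ x)
  · rw [emultiplicity_prod_sub (by simpa using h0S), Int.cast_zero, hmem h0S]

end zmodVal

open Finset in
/-- A polynomial of total degree less than the number of variables has vanishing alternating
sum over the vertices of the unit cube. -/
lemma MvPolynomial.sum_neg_one_pow_card_mul_eval {σ R : Type*} [Fintype σ] [DecidableEq σ]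
    [CommRing R] (f : MvPolynomial σ R) (hf : f.totalDegree < Fintype.card σ) :
    ∑ J : Finset σ, (-1) ^ #J * eval (fun i => if i ∈ J then 1 else 0) f = 0 := by
  simp_rw [eval_eq', mul_sum]
  rw [sum_comm]
  refine sum_eq_zero fun s hs => ?_
  obtain ⟨j, hj⟩ : ∃ j, s j = 0 := by
    by_contra! h
    have h1 : Fintype.card σ ≤ ∑ i, s i := by
      simpa using card_nsmul_le_sum univ s 1 fun i _ => Nat.one_le_iff_ne_zero.2 (h i)
    have h2 := le_totalDegree hs
    rw [Finsupp.sum_fintype _ _ fun _ => rfl] at h2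
    lia
  have h0 : ∏ i, ((-1 : R) + 0 ^ s i) = 0 := prod_eq_zero (mem_univ j) (by simp [hj])
  rw [prod_add, powerset_univ] at h0
  refine Eq.trans ?_ (mul_eq_zero_of_right (coeff s f) h0)
  rw [mul_sum]
  refine sum_congr rfl fun J _ => ?_
  have h1 : ∏ i ∈ J, (if i ∈ J then (1 : R) else 0) ^ s i = 1 :=
    prod_eq_one fun i hi => by rw [if_pos hi, one_pow]
  have h2 : ∏ i ∈ univ \ J, (if i ∈ J then (1 : R) else 0) ^ s i = ∏ i ∈ univ \ J, 0 ^ s i :=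
    prod_congr rfl fun i hi => by rw [if_neg (mem_sdiff.1 hi).2]
  rw [← prod_sdiff (subset_univ J), h1, h2, prod_const]
  ring

/-- **Theorem of Alon, Friedland and Kalai.** For `d 1 ≥ … ≥ d n ≥ 1` and
`0 ∈ Q i ⊆ ℤ/p^{d i}ℤ`: if `m > Σᵢ (p ^ d i − card_p (Q i))`, then for all
integers `a i j` there is a nonempty `J ⊆ {1,…,m}` such that the residue of
`Σ_{j ∈ J} a i j` modulo `p ^ d i` lies in `Q i` for every `i`. -/
theorem alon_friedland_kalai (p n m : ℕ) (hp : p.Prime)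
    (d : Fin n → ℕ) (hd1 : ∀ i, 1 ≤ d i)
    (hmono : ∀ i j : Fin n, i ≤ j → d j ≤ d i)
    (Q : (i : Fin n) → Finset (ZMod (p ^ d i)))
    (hQ0 : ∀ i, (0 : ZMod (p ^ d i)) ∈ Q i)
    (hm : ∑ i, (p ^ d i - cardp p (Q i)) < m) :
    ∀ a : Fin n → Fin m → ℤ,
      ∃ J : Finset (Fin m), J.Nonempty ∧
        ∀ i, ((∑ j ∈ J, a i j : ℤ) : ZMod (p ^ d i)) ∈ Q i := by
  intro a
  have := Fact.mk hp
  choose R v hcard hdvd hdvd_succ hv using fun i =>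
    exists_finset_emultiplicity_prod_sub (Nat.one_le_iff_ne_zero.1 (hd1 i)) (hQ0 i)
  by_contra! hJ
  let F : MvPolynomial (Fin m) ℤ := ∏ i, ∏ r ∈ R i,
    ((∑ j, MvPolynomial.C (a i j) * MvPolynomial.X j) - MvPolynomial.C (r.val : ℤ))
  have hF : F.totalDegree < Fintype.card (Fin m) := by
    rw [Fintype.card_fin]
    refine lt_of_le_of_lt ?_ hm
    refine (MvPolynomial.totalDegree_finsetProd _ _).trans (Finset.sum_le_sum fun i _ => ?_)
    refine (MvPolynomial.totalDegree_finsetProd _ _).trans ?_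
    rw [← hcard, Finset.card_eq_sum_ones]
    refine Finset.sum_le_sum fun r _ => (MvPolynomial.totalDegree_sub_C_le _ _).trans ?_
    refine MvPolynomial.totalDegree_finsetSum_le fun j _ => ?_
    refine (MvPolynomial.totalDegree_mul _ _).trans ?_
    rw [MvPolynomial.totalDegree_C, MvPolynomial.totalDegree_X]
  have heval (J : Finset (Fin m)) : MvPolynomial.eval (fun j => if j ∈ J then 1 else 0) F =
      ∏ i, ∏ r ∈ R i, ((∑ j ∈ J, a i j) - (r.val : ℤ)) := by
    have hC (z : ℤ) : MvPolynomial.eval (fun j => if j ∈ J then 1 else 0)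
        (MvPolynomial.C z : MvPolynomial (Fin m) ℤ) = z := MvPolynomial.eval_C z
    simp only [F, map_prod, map_sub, map_sum, map_mul, hC, MvPolynomial.eval_X, mul_ite, mul_one,
      mul_zero, Finset.sum_ite_mem, Finset.univ_inter]
  have hsum := MvPolynomial.sum_neg_one_pow_card_mul_eval F hF
  rw [← Finset.add_sum_erase _ _ (Finset.mem_univ ∅)] at hsum
  simp only [heval, Finset.sum_empty, Finset.card_empty, pow_zero, one_mul] at hsum
  have hmult : emultiplicity (p : ℤ) (∏ i, ∏ r ∈ R i, (0 - (r.val : ℤ))) = (∑ i, v i : ℕ) := by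
    rw [Finset.emultiplicity_prod (Nat.prime_iff_prime_int.1 hp), Nat.cast_sum]
    exact Finset.sum_congr rfl fun i _ => hv i
  refine (emultiplicity_eq_coe.1 hmult).2 ?_
  rw [eq_neg_of_add_eq_zero_left hsum, dvd_neg]
  refine Finset.dvd_sum fun J hmem => Dvd.dvd.mul_left ?_ _
  obtain ⟨i, hi⟩ := hJ J (Finset.nonempty_iff_ne_empty.2 (Finset.ne_of_mem_erase hmem))
  rw [← Finset.add_sum_erase _ _ (Finset.mem_univ i), ← Finset.mul_prod_erase _ _ (Finset.mem_univ i), add_right_comm,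
    pow_add]
  refine mul_dvd_mul (hdvd_succ i _ hi) ?_
  rw [← Finset.prod_pow_eq_pow_sum]
  exact Finset.prod_dvd_prod_of_dvd _ _ fun k _ => hdvd k _
end

section
/- Let p be a prime, let d_1 ≥ d_2 ≥ … ≥ d_n ≥ 1 be integers, and for each i let Q_i ⊆ ℤ/p^{d_i}ℤ be a set containing 0. If m > Σ_{i=1}^n price((ℤ/p^{d_i}ℤ) \ Q_i), then for all integers a_{ij} (i = 1,…,n, j = 1,…,m) there exists a nonempty subset J ⊆ {1,…,m} such that for every i, the residue of Σ_{j∈J} a_{ij} modulo p^{d_i} belongs to Q_i. -/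
/-- `h : ℚ[x]` is integer-valued: it takes integer values at all integers. -/
def IntValued (h : Polynomial ℚ) : Prop :=
  ∀ t : ℤ, ∃ z : ℤ, Polynomial.eval (t : ℚ) h = (z : ℚ)

/-- `H` is a covering set for `B ⊆ ℤ/p^dℤ`: a finite set of integer-valued
rational polynomials `h` with `p ∤ h 0`, such that every integer `b` whose
residue modulo `p ^ d` lies in `B` satisfies `p ∣ h b` for some `h ∈ H`. -/
def CoversSet (p d : ℕ) (H : Finset (Polynomial ℚ)) (B : Set (ZMod (p ^ d))) : Prop :=
  (∀ h ∈ H, IntValued h) ∧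
  (∀ h ∈ H, ∀ z : ℤ, Polynomial.eval (0 : ℚ) h = (z : ℚ) → ¬ (p : ℤ) ∣ z) ∧
  (∀ b : ℤ, ((b : ZMod (p ^ d)) ∈ B) →
    ∃ h ∈ H, ∃ z : ℤ, Polynomial.eval (b : ℚ) h = (z : ℚ) ∧ (p : ℤ) ∣ z)

/-- `price B` is the minimum total degree `Σ_{h ∈ H} deg h` over all covering
sets `H` of `B`. -/
noncomputable def price (p d : ℕ) (B : Set (ZMod (p ^ d))) : ℕ :=
  sInf {s : ℕ | ∃ H : Finset (Polynomial ℚ),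
    CoversSet p d H B ∧ s = ∑ h ∈ H, h.natDegree}

open Polynomial in
/-- The binomial coefficient `(x - 1).choose k` as a rational polynomial in `x`. -/
noncomputable def shiftedChoosePoly (k : ℕ) : ℚ[X] :=
  C ((k.factorial : ℚ)⁻¹) * (descPochhammer ℚ k).comp (X - 1)

theorem eval_shiftedChoosePoly (k : ℕ) (b : ℤ) :
    (shiftedChoosePoly k).eval (b : ℚ) = (Ring.choose (b - 1) k : ℤ) := by
  have h1 : ((Ring.choose (b - 1) k : ℤ) : ℚ) = Ring.choose ((b : ℚ) - 1) k := by
    simpa using Ring.map_choose (Int.castRingHom ℚ) (b - 1) k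
  rw [h1, Ring.choose_eq_smul, ← Polynomial.aeval_eq_smeval, ← Polynomial.eval_map_algebraMap,
    descPochhammer_map]
  simp [shiftedChoosePoly]

/-- Every subset of `ℤ/p^dℤ` that avoids `0` is covered by a single binomial coefficient. -/
theorem coversSet_shiftedChoosePoly {p : ℕ} (hp : p.Prime) (d : ℕ) {B : Set (ZMod (p ^ d))}
    (hB : 0 ∉ B) : CoversSet p d {shiftedChoosePoly (p ^ d - 1)} B := by
  have hpos : 0 < p ^ d := pow_pos hp.pos d
  refine ⟨?_, ?_, ?_⟩
  · intro h hh t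
    rw [Finset.mem_singleton.mp hh]
    exact ⟨_, eval_shiftedChoosePoly _ t⟩
  · intro h hh z hz
    rw [Finset.mem_singleton.mp hh, ← Int.cast_zero, eval_shiftedChoosePoly, Int.cast_inj] at hz
    rw [← hz, zero_sub, Ring.choose_neg']
    have hc : Ring.multichoose (1 : ℤ) (p ^ d - 1) = 1 := Ring.multichoose_one _
    rw [hc, Units.smul_def, smul_eq_mul, mul_one]
    exact fun hdvd => (Nat.prime_iff_prime_int.mp hp).not_isUnit
      (isUnit_of_dvd_unit hdvd (Units.isUnit _))
  · intro b hb
    refine ⟨_, Finset.mem_singleton_self _, _, eval_shiftedChoosePoly _ b, ?_⟩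
    by_contra hndvd
    have key := Ring.choose_add_smul_choose (b - 1) (p ^ d - 1) 1
    rw [Nat.choose_one_right, Nat.sub_add_cancel hpos, Nat.cast_one, sub_add_cancel,
      Ring.choose_one_right, nsmul_eq_mul] at key
    have hcop : IsCoprime ((p ^ d : ℕ) : ℤ) (Ring.choose (b - 1) (p ^ d - 1)) := by
      rw [Nat.cast_pow]
      exact ((Nat.prime_iff_prime_int.mp hp).coprime_iff_not_dvd.mpr hndvd).pow_left
    have hdvd : ((p ^ d : ℕ) : ℤ) ∣ b := hcop.dvd_of_dvd_mul_right ⟨_, key.symm⟩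
    rw [(ZMod.intCast_zmod_eq_zero_iff_dvd _ _).mpr hdvd] at hb
    exact hB hb

theorem exists_coversSet_sum_natDegree_eq_price {p : ℕ} (hp : p.Prime) (d : ℕ)
    {B : Set (ZMod (p ^ d))} (hB : 0 ∉ B) :
    ∃ H : Finset (Polynomial ℚ), CoversSet p d H B ∧ ∑ h ∈ H, h.natDegree = price p d B := by
  obtain ⟨H, hH, h⟩ := Nat.sInf_mem (s := {s : ℕ | ∃ H : Finset (Polynomial ℚ),
    CoversSet p d H B ∧ s = ∑ h ∈ H, h.natDegree}) ⟨_, _, coversSet_shiftedChoosePoly hp d hB, rfl⟩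
  exact ⟨H, hH, h.symm⟩

namespace MvPolynomial

/-- The alternating sum over the vertices of the cube of a polynomial whose degree is less than
the dimension vanishes. -/
theorem sum_neg_one_pow_card_mul_eval_indicator {R σ : Type*} [CommRing R] [Fintype σ]
    [DecidableEq σ] (F : MvPolynomial σ R) (hF : F.totalDegree < Fintype.card σ) :
    ∑ J : Finset σ, (-1) ^ J.card * eval (fun j => if j ∈ J then 1 else 0) F = 0 := by
  simp_rw [eval_eq, Finset.mul_sum]
  rw [Finset.sum_comm]
  refine Finset.sum_eq_zero fun e he => ?_
  have hlt : e.support.card < Fintype.card σ := by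
    refine lt_of_le_of_lt ?_ ((le_totalDegree he).trans_lt hF)
    rw [Finset.card_eq_sum_ones]
    exact Finset.sum_le_sum fun j hj => Nat.one_le_iff_ne_zero.mpr (Finsupp.mem_support_iff.mp hj)
  obtain ⟨j₀, hj₀⟩ : ∃ j, j ∉ e.support := by
    by_contra! h
    exact hlt.ne (by rw [Finset.eq_univ_iff_forall.mpr h, Finset.card_univ])
  have hprod : ∏ j, ((-1 : R) + if e j = 0 then 1 else 0) = 0 :=
    Finset.prod_eq_zero (Finset.mem_univ j₀) (by simp [Finsupp.notMem_support_iff.mp hj₀])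
  rw [Finset.prod_add, Finset.powerset_univ] at hprod
  refine Eq.trans ?_ (mul_eq_zero_of_right (coeff e F) hprod)
  rw [Finset.mul_sum]
  refine Finset.sum_congr rfl fun J _ => ?_
  rw [Finset.prod_const, mul_left_comm]
  congr 2
  rw [Finset.prod_ite_zero, Finset.prod_subset (Finset.subset_univ e.support)
    (fun j _ hj => by simp [Finsupp.notMem_support_iff.mp hj])]
  simp_rw [ite_pow, one_pow]
  rw [← Finset.prod_sdiff (Finset.subset_univ J),
    Finset.prod_eq_one (s := J) (fun j hj => by simp [hj]), mul_one, ← Finset.prod_ite_zero]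
  refine Finset.prod_congr rfl fun j hj => ?_
  rw [if_neg (Finset.mem_sdiff.mp hj).2, zero_pow_eq]

theorem totalDegree_aeval_le {R σ : Type*} [CommSemiring R] (h : Polynomial R)
    (L : MvPolynomial σ R) (hL : L.totalDegree ≤ 1) :
    (Polynomial.aeval L h).totalDegree ≤ h.natDegree := by
  rw [Polynomial.aeval_eq_sum_range]
  refine totalDegree_finsetSum_le fun k hk => (totalDegree_smul_le _ _).trans ?_
  calc (L ^ k).totalDegree ≤ k * L.totalDegree := totalDegree_pow _ _
    _ ≤ k * 1 := Nat.mul_le_mul_left k hL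
    _ ≤ h.natDegree := by rw [mul_one]; exact Nat.lt_succ_iff.mp (Finset.mem_range.mp hk)

end MvPolynomial

/-- A product of polynomials in subset sums, of total degree less than the number of summands,
has vanishing alternating sum over all subsets. -/
theorem sum_neg_one_pow_card_mul_prod_eval {ι σ : Type*} [Fintype ι] [Fintype σ] [DecidableEq σ]
    (H : ι → Finset (Polynomial ℚ)) (a : ι → σ → ℤ)
    (hdeg : ∑ i, ∑ h ∈ H i, h.natDegree < Fintype.card σ) :
    ∑ J : Finset σ, (-1) ^ J.card *
      ∏ i, ∏ h ∈ H i, h.eval (((∑ j ∈ J, a i j : ℤ)) : ℚ) = 0 := by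
  let L : ι → MvPolynomial σ ℚ := fun i => ∑ j, (a i j : ℚ) • MvPolynomial.X j
  have hL : ∀ i, (L i).totalDegree ≤ 1 := fun i =>
    MvPolynomial.totalDegree_finsetSum_le fun j _ =>
      (MvPolynomial.totalDegree_smul_le _ _).trans (MvPolynomial.totalDegree_X j).le
  have hF := MvPolynomial.sum_neg_one_pow_card_mul_eval_indicator
    (∏ i, ∏ h ∈ H i, Polynomial.aeval (L i) h) <| by
      refine lt_of_le_of_lt ((MvPolynomial.totalDegree_finsetProd _ _).trans ?_) hdeg
      refine Finset.sum_le_sum fun i _ => (MvPolynomial.totalDegree_finsetProd _ _).trans ?_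
      exact Finset.sum_le_sum fun h _ => MvPolynomial.totalDegree_aeval_le h _ (hL i)
  rw [← hF]
  refine Finset.sum_congr rfl fun J _ => ?_
  simp_rw [map_prod]
  congr 1
  refine Finset.prod_congr rfl fun i _ => Finset.prod_congr rfl fun h _ => ?_
  rw [← MvPolynomial.coe_aeval_eq_eval, RingHom.coe_coe, ← Polynomial.aeval_algHom_apply,
    Polynomial.coe_aeval_eq_eval]
  simp [L, Finset.sum_ite_mem]

/-- **Generalized Olson bound via `price`.** For `d 1 ≥ … ≥ d n ≥ 1` and
`0 ∈ Q i ⊆ ℤ/p^{d i}ℤ`: if `m > Σᵢ price((ℤ/p^{d i}ℤ) \ Q i)`, then for all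
integers `a i j` there is a nonempty `J ⊆ {1,…,m}` such that the residue of
`Σ_{j ∈ J} a i j` modulo `p ^ d i` lies in `Q i` for every `i`. -/
theorem generalized_olson (p n m : ℕ) (hp : p.Prime)
    (d : Fin n → ℕ) (hd1 : ∀ i, 1 ≤ d i)
    (hmono : ∀ i j : Fin n, i ≤ j → d j ≤ d i)
    (Q : (i : Fin n) → Set (ZMod (p ^ d i)))
    (hQ0 : ∀ i, (0 : ZMod (p ^ d i)) ∈ Q i)
    (hm : ∑ i, price p (d i) ((Q i)ᶜ) < m) :
    ∀ a : Fin n → Fin m → ℤ,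
      ∃ J : Finset (Fin m), J.Nonempty ∧
        ∀ i, ((∑ j ∈ J, a i j : ℤ) : ZMod (p ^ d i)) ∈ Q i := by
  classical
  intro a
  by_contra! hcon
  choose H hH hdeg using fun i =>
    exists_coversSet_sum_natDegree_eq_price hp (d i) (B := (Q i)ᶜ) (fun h => h (hQ0 i))
  have hfloor : ∀ i, ∀ h ∈ H i, ∀ t : ℤ, h.eval (t : ℚ) = (⌊h.eval (t : ℚ)⌋ : ℤ) := by
    intro i h hh t
    obtain ⟨z, hz⟩ := (hH i).1 h hh t
    rw [hz, Int.floor_intCast]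
  let F : Finset (Fin m) → ℤ := fun J =>
    ∏ i, ∏ h ∈ H i, ⌊h.eval (((∑ j ∈ J, a i j : ℤ)) : ℚ)⌋
  have hsum : ∑ J, (-1) ^ J.card * F J = 0 := by
    have h := sum_neg_one_pow_card_mul_prod_eval H a (by simpa [hdeg] using hm)
    have hF : ∀ J, ((F J : ℤ) : ℚ) =
        ∏ i, ∏ h ∈ H i, h.eval (((∑ j ∈ J, a i j : ℤ)) : ℚ) := by
      intro J
      rw [Int.cast_prod]
      refine Finset.prod_congr rfl fun i _ => ?_
      rw [Int.cast_prod]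
      exact Finset.prod_congr rfl fun h hh => (hfloor i h hh _).symm
    simp_rw [← hF] at h
    exact_mod_cast h
  have hpZ := Nat.prime_iff_prime_int.mp hp
  have hdvd : ∀ J : Finset (Fin m), J.Nonempty → (p : ℤ) ∣ F J := by
    intro J hJ
    obtain ⟨i, hi⟩ := hcon J hJ
    obtain ⟨h, hh, z, hz, hpz⟩ := (hH i).2.2 _ hi
    refine dvd_trans ?_ (Finset.dvd_prod_of_mem _ (Finset.mem_univ i))
    refine dvd_trans ?_ (Finset.dvd_prod_of_mem _ hh)
    rwa [hz, Int.floor_intCast]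
  have hempty : ¬ (p : ℤ) ∣ F ∅ := by
    intro hdiv
    obtain ⟨i, _, hi⟩ := hpZ.exists_mem_finset_dvd hdiv
    obtain ⟨h, hh, hi⟩ := hpZ.exists_mem_finset_dvd hi
    exact (hH i).2.1 h hh _ (by simpa using hfloor i h hh 0) (by simpa using hi)
  rw [← Finset.add_sum_erase _ _ (Finset.mem_univ ∅)] at hsum
  refine hempty ?_
  have hrest : (p : ℤ) ∣ ∑ J ∈ Finset.univ.erase (∅ : Finset (Fin m)), (-1) ^ J.card * F J :=
    Finset.dvd_sum fun J hJ =>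
      (hdvd J (Finset.nonempty_iff_ne_empty.mpr (Finset.ne_of_mem_erase hJ))).mul_left _
  rw [Finset.card_empty, pow_zero, one_mul] at hsum
  rw [eq_neg_of_add_eq_zero_left hsum]
  exact hrest.neg_right
end

section
/- Let f = Σ_{i=1}^k p_i be a polynomial in ℤ[x_1,…,x_m] written as a sum of k monomials p_i each with coefficient 1, and let h(x) = Σ_{r=0}^D α_r·C(x,r) with integers α_r, where C(x,r) denotes the binomial coefficient polynomial. Then for every vector s ∈ {0,1}^m, Ψ^h(f)(s) = h(f(s)). -/
/-- A product of `0`-`1` values is again `0` or `1`, so a monomial with coefficient `1` takes only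
these values on `0`-`1` vectors. -/
theorem MvPolynomial.eval_monomial_one_eq_zero_or_one {σ R : Type*} [CommSemiring R]
    (c : σ →₀ ℕ) {s : σ → R} (hs : ∀ j, s j = 0 ∨ s j = 1) :
    eval s (monomial c 1) = 0 ∨ eval s (monomial c 1) = 1 := by
  rw [eval_monomial, one_mul]
  refine Finset.prod_induction _ (fun x => x = 0 ∨ x = 1) ?_ (Or.inr rfl) fun j _ => ?_
  · rintro a b (rfl | rfl) (rfl | rfl) <;> simp
  · rcases hs j with h | h
    · rcases eq_or_ne (c j) 0 with h0 | h0 <;> simp [h, h0]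
    · simp [h]

/-- The `r`-th elementary symmetric function of `0`-`1` values is the binomial coefficient of their
sum. -/
theorem Finset.sum_powersetCard_prod_eq_choose_sum {ι R : Type*} [CommRing R] [BinomialRing R]
    (t : Finset ι) {v : ι → R} (hv : ∀ i, v i = 0 ∨ v i = 1) (r : ℕ) :
    ∑ A ∈ t.powersetCard r, ∏ i ∈ A, v i = Ring.choose (∑ i ∈ t, v i) r := by
  classical
  have hite (i : ι) : v i = if v i = 1 then 1 else 0 := by
    rcases hv i with h | h
    · split_ifs with h1
      exacts [h1, h]
    · simp [h]
  have hfilter : {A ∈ t.powersetCard r | ∀ i ∈ A, v i = 1} =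
      {i ∈ t | v i = 1}.powersetCard r := by
    ext A
    simp only [mem_filter, mem_powersetCard, subset_iff]
    grind
  rw [sum_congr rfl fun A _ => prod_congr rfl fun i _ => hite i, sum_congr rfl fun i _ => hite i]
  simp only [prod_ite_zero, prod_const_one, sum_boole, hfilter, card_powersetCard,
    Ring.choose_natCast]

/-- **Lemma on `Ψ^h(f)`.** Let `f = Σ_{i} P i` be a sum of `k` monomials with
coefficient `1` in `ℤ[x_1,…,x_m]`, and let `h(x) = Σ_{r=0}^{D} α r · C(x,r)`
with integer `α r`, where `C(x,r)` is the binomial coefficient polynomial.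
With `Ψ_r(f) = Σ_{A ⊆ {1,…,k}, |A| = r} Π_{i ∈ A} P i` and
`Ψ^h(f) = Σ_{r=0}^{D} α r · Ψ_r(f)`, every `0`-`1` vector `s` satisfies
`Ψ^h(f)(s) = h(f(s))`. -/
theorem psi_h_eval (m k D : ℕ)
    (P : Fin k → MvPolynomial (Fin m) ℤ)
    (hP : ∀ i, ∃ c : Fin m →₀ ℕ, P i = MvPolynomial.monomial c 1)
    (α : ℕ → ℤ)
    (s : Fin m → ℤ) (hs : ∀ j, s j = 0 ∨ s j = 1) :
    MvPolynomial.eval s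
        (∑ r ∈ Finset.range (D + 1),
          α r • ∑ A ∈ Finset.powersetCard r (Finset.univ : Finset (Fin k)),
            ∏ i ∈ A, P i)
      = ∑ r ∈ Finset.range (D + 1),
          α r * Ring.choose (MvPolynomial.eval s (∑ i, P i)) r := by
  have hv (i : Fin k) : MvPolynomial.eval s (P i) = 0 ∨ MvPolynomial.eval s (P i) = 1 := by
    obtain ⟨c, hc⟩ := hP i
    rw [hc]
    exact MvPolynomial.eval_monomial_one_eq_zero_or_one c hs
  simp only [map_sum, map_zsmul, map_prod, smul_eq_mul,
    Finset.sum_powersetCard_prod_eq_choose_sum _ hv]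
end

section
/- Let p be a prime, d ≥ 1, and let Q' be a set of integers whose residues modulo p^d are pairwise distinct modulo p (i.e., its elements represent distinct residues modulo p), with 0 ∈ Q'. Let S be a set of integer representatives of the residues in (ℤ/p^dℤ) \ Q'. Then for every integer T, the product ∏_{q ∈ S} (T − q) is divisible by p^δ, where δ = Σ_{r=0}^{d−1} (p^r − 1). Consequently, h(T) = (1/p^δ)·∏_{q ∈ S} (T − q) is an integer-valued polynomial. -/
theorem pow_card_filter_dvd (p : ℤ) (A : Finset ℕ) (hA : ∀ r ∈ A, 1 ≤ r) (n : ℤ) :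
    p ^ (A.filter fun r => p ^ r ∣ n).card ∣ n := by
  set B := A.filter fun r => p ^ r ∣ n with hB
  rcases B.eq_empty_or_nonempty with h | h
  · simp [h]
  · have hmax := Finset.mem_filter.mp (B.max'_mem h)
    have hsub : B ⊆ Finset.Icc 1 (B.max' h) := fun r hr =>
      Finset.mem_Icc.mpr ⟨hA r (Finset.mem_filter.mp hr).1, B.le_max' r hr⟩
    have hcard : B.card ≤ B.max' h := by simpa using Finset.card_le_card hsub
    exact (pow_dvd_pow p hcard).trans hmax.2

/-- A product is divisible by `p` to the power obtained by counting, for every `r` in a set of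
positive exponents, the factors divisible by `p ^ r`. -/
theorem pow_sum_card_filter_dvd_prod {ι : Type*} (p : ℤ) (A : Finset ℕ) (hA : ∀ r ∈ A, 1 ≤ r)
    (S : Finset ι) (f : ι → ℤ) :
    p ^ (∑ r ∈ A, (S.filter fun q => p ^ r ∣ f q).card) ∣ ∏ q ∈ S, f q := by
  have hcomm : ∑ r ∈ A, (S.filter fun q => p ^ r ∣ f q).card
      = ∑ q ∈ S, (A.filter fun r => p ^ r ∣ f q).card := by
    simp only [Finset.card_filter]
    exact Finset.sum_comm
  rw [hcomm, ← Finset.prod_pow_eq_pow_sum]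
  exact Finset.prod_dvd_prod_of_dvd _ _ fun q _ => pow_card_filter_dvd p A hA (f q)

/-- If every residue modulo `p ^ d` is represented by `S` or by a set `Q` of integers that are
distinct modulo `p`, then `S` contains at least `p ^ (d - r) - 1` integers congruent to `T`
modulo `p ^ r`. -/
theorem pow_sub_one_le_card_filter_dvd_sub {p d r : ℕ} (hp : 0 < p) (hr : 1 ≤ r) (hrd : r ≤ d)
    {Q S : Finset ℤ}
    (hQ : ∀ q₁ ∈ Q, ∀ q₂ ∈ Q, q₁ ≠ q₂ → ¬ (p : ℤ) ∣ (q₁ - q₂))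
    (hcover : ∀ t : ZMod (p ^ d),
      (∃ s ∈ S, (s : ZMod (p ^ d)) = t) ∨ ∃ q ∈ Q, (q : ZMod (p ^ d)) = t) (T : ℤ) :
    p ^ (d - r) - 1 ≤ (S.filter fun q => (p : ℤ) ^ r ∣ T - q).card := by
  classical
  have hdvd : ∀ a b : ℤ, (a : ZMod (p ^ d)) = b → (p : ℤ) ^ d ∣ b - a := fun a b h => by
    simpa using (ZMod.intCast_eq_intCast_iff_dvd_sub a b _).mp h
  have hpd : (p : ℤ) ^ d = (p : ℤ) ^ r * (p : ℤ) ^ (d - r) := by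
    rw [← pow_add, Nat.add_sub_cancel' hrd]
  have hpr : (p : ℤ) ^ r ∣ (p : ℤ) ^ d := pow_dvd_pow _ hrd
  let g : ℕ → ZMod (p ^ d) := fun j => ((T + (p : ℤ) ^ r * j : ℤ) : ZMod (p ^ d))
  have hg_inj : Set.InjOn g (Finset.range (p ^ (d - r))) := by
    intro i hi j hj hij
    have h := hdvd _ _ hij
    rw [hpd, show T + (p : ℤ) ^ r * j - (T + (p : ℤ) ^ r * i) = (p : ℤ) ^ r * ((j : ℤ) - i) by ring]
      at h
    have h' := Int.dvd_of_mul_dvd_mul_left (by positivity) h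
    have hmod : i ≡ j [MOD p ^ (d - r)] := (Nat.modEq_iff_dvd).mpr (by exact_mod_cast h')
    exact hmod.eq_of_lt_of_lt (by simpa using hi) (by simpa using hj)
  have hclass : ∀ (a : ℤ) (j : ℕ), (a : ZMod (p ^ d)) = g j → (p : ℤ) ^ r ∣ T - a := by
    intro a j h
    have h' := hpr.trans (hdvd _ _ h)
    rw [show T + (p : ℤ) ^ r * j - a = (T - a) + (p : ℤ) ^ r * j by ring] at h'
    exact (dvd_add_left (dvd_mul_right _ _)).mp h'
  let SF := S.filter fun q => (p : ℤ) ^ r ∣ T - q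
  let QF := Q.filter fun q => (p : ℤ) ^ r ∣ T - q
  have hQF : QF.card ≤ 1 := by
    refine Finset.card_le_one.mpr fun a ha b hb => ?_
    obtain ⟨ha, ha'⟩ := Finset.mem_filter.mp ha
    obtain ⟨hb, hb'⟩ := Finset.mem_filter.mp hb
    by_contra hab
    refine hQ a ha b hb hab ((dvd_pow_self (p : ℤ) (by omega : r ≠ 0)).trans ?_)
    simpa using dvd_sub hb' ha'
  have hsub : (Finset.range (p ^ (d - r))).image g ⊆
      (SF ∪ QF).image fun a : ℤ => (a : ZMod (p ^ d)) := by
    intro t ht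
    obtain ⟨j, -, rfl⟩ := Finset.mem_image.mp ht
    rcases hcover (g j) with ⟨a, ha, h⟩ | ⟨a, ha, h⟩
    · exact Finset.mem_image.mpr ⟨a, Finset.mem_union_left _
        (Finset.mem_filter.mpr ⟨ha, hclass a j h⟩), h⟩
    · exact Finset.mem_image.mpr ⟨a, Finset.mem_union_right _
        (Finset.mem_filter.mpr ⟨ha, hclass a j h⟩), h⟩
  have hcard := (Finset.card_le_card hsub).trans
    (Finset.card_image_le.trans (Finset.card_union_le _ _))
  rw [Finset.card_image_of_injOn hg_inj, Finset.card_range] at hcard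
  change _ ≤ SF.card
  omega

/-- **Integrality of the Alon–Friedland–Kalai covering polynomial.**
Let `Q'` be a set of integers containing `0` whose elements are pairwise
distinct modulo `p`, and let `S` be a set of integer representatives of the
residues modulo `p ^ d` not represented by `Q'`. Then for every integer `T`
the product `Π_{q ∈ S} (T − q)` is divisible by `p ^ δ`, where
`δ = Σ_{r=0}^{d−1} (p ^ r − 1)`; consequently
`h(T) = (1 / p ^ δ) · Π_{q ∈ S} (T − q)` is an integer-valued polynomial. -/
theorem afk_polynomial_integer_valued
    (p d : ℕ) (hp : p.Prime) (hd : 1 ≤ d)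
    (Q' S : Finset ℤ)
    (hQ0 : (0 : ℤ) ∈ Q')
    (hQdist : ∀ q₁ ∈ Q', ∀ q₂ ∈ Q', q₁ ≠ q₂ → ¬ (p : ℤ) ∣ (q₁ - q₂))
    (hSinj : ∀ s₁ ∈ S, ∀ s₂ ∈ S, ((s₁ : ZMod (p ^ d)) = (s₂ : ZMod (p ^ d))) → s₁ = s₂)
    (hScompl : ∀ t : ZMod (p ^ d),
      (∃ s ∈ S, (s : ZMod (p ^ d)) = t) ↔ ¬ ∃ q ∈ Q', (q : ZMod (p ^ d)) = t) :
    ∀ T : ℤ, (p : ℤ) ^ (∑ r ∈ Finset.range d, (p ^ r - 1)) ∣ ∏ q ∈ S, (T - q) := by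
  intro T
  have hcover : ∀ t : ZMod (p ^ d),
      (∃ s ∈ S, (s : ZMod (p ^ d)) = t) ∨ ∃ q ∈ Q', (q : ZMod (p ^ d)) = t := fun t =>
    or_iff_not_imp_right.mpr (hScompl t).mpr
  have hprod := pow_sum_card_filter_dvd_prod (p : ℤ) ((Finset.range d).image fun r => d - r)
    (by simp only [Finset.mem_image, Finset.mem_range]; rintro _ ⟨r, hr, rfl⟩; omega)
    S fun q => T - q
  refine (pow_dvd_pow _ ?_).trans hprod
  rw [Finset.sum_image fun i hi j hj h => by
    simp only [Finset.coe_range, Set.mem_Iio] at hi hj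
    omega]
  refine Finset.sum_le_sum fun r hr => ?_
  have hr := Finset.mem_range.mp hr
  have h := pow_sub_one_le_card_filter_dvd_sub (r := d - r) hp.pos (by omega) (by omega)
    hQdist hcover T
  rwa [Nat.sub_sub_self hr.le] at h
end

section
/- Let p be a prime, d ≥ 1, and let Q' be a set of integers whose residues modulo p^d are pairwise distinct modulo p, with 0 ∈ Q'. Let S be a set of integer representatives of the residues in (ℤ/p^dℤ) \ Q', and set δ = Σ_{r=0}^{d−1} (p^r − 1) and h(T) = (1/p^δ)·∏_{q ∈ S} (T − q). Then for every integer T, p divides h(T) if and only if T ≡ q (mod p^d) for some q ∈ S; equivalently, p^{δ+1} divides ∏_{q ∈ S}(T − q) if and only if T is congruent modulo p^d to some element of S. In particular p ∤ h(0). -/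
/-- A complete residue system modulo `a * b` contains exactly `b` representatives of each
residue class modulo `a`. -/
theorem card_filter_dvd_sub_of_complete_residues {a b : ℕ} (ha : 0 < a) (hb : 0 < b)
    {R : Finset ℤ} (hR : ∀ x : ℤ, ∃! q, q ∈ R ∧ ((a * b : ℕ) : ℤ) ∣ x - q) (T : ℤ) :
    (R.filter fun q => (a : ℤ) ∣ T - q).card = b := by
  have hab : (a : ℤ) ∣ ((a * b : ℕ) : ℤ) := ⟨b, by push_cast; ring⟩
  have hcount : (R.filter fun q => (a : ℤ) ∣ T - q).card = (Finset.range b).card := by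
    symm
    choose f hf hfu using hR
    refine Finset.card_bij (fun i _ => f (T + a * i)) ?_ ?_ ?_
    · intro i _
      have h := hf (T + a * i)
      refine Finset.mem_filter.2 ⟨h.1, ?_⟩
      have h1 := hab.trans h.2
      have h2 : (a : ℤ) ∣ a * i := dvd_mul_right _ _
      have := dvd_sub h1 h2
      rwa [show T + a * i - f (T + a * i) - a * i = T - f (T + a * i) by ring] at this
    · intro i hi j hj hij
      have hi' := (hf (T + a * i)).2
      have hj' := (hf (T + a * j)).2
      rw [hij] at hi'
      have h := dvd_sub hi' hj'
      rw [show T + (a : ℤ) * i - f (T + a * j) - (T + a * j - f (T + a * j)) = a * (i - j) by ring]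
        at h
      push_cast at h
      have h := (mul_dvd_mul_iff_left (by exact_mod_cast ha.ne' : (a : ℤ) ≠ 0)).1 h
      have hi := Finset.mem_range.1 hi
      have hj := Finset.mem_range.1 hj
      have := Int.eq_zero_of_abs_lt_dvd h (abs_lt.2 ⟨by omega, by omega⟩)
      omega
    · intro q hq
      obtain ⟨hqR, c, hc⟩ := Finset.mem_filter.1 hq
      have hb' : (0 : ℤ) < b := by exact_mod_cast hb
      have h0 := Int.emod_nonneg (-c) hb'.ne'
      have h1 := Int.emod_lt_of_pos (-c) hb'
      refine ⟨((-c) % (b : ℤ)).toNat, Finset.mem_range.2 (by omega), ?_⟩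
      refine (hfu _ q ⟨hqR, ?_⟩).symm
      rw [Int.toNat_of_nonneg h0]
      have h2 := Int.emod_add_mul_ediv (-c) (b : ℤ)
      refine ⟨-(-c / (b : ℤ)), ?_⟩
      push_cast
      linear_combination hc + (a : ℤ) * h2
  rw [hcount, Finset.card_range]

/-- The exponent of `p` in `x`, truncated at `d`. -/
def truncatedExponent (p d : ℕ) (x : ℤ) : ℕ :=
  ((Finset.range d).filter fun j => (p : ℤ) ^ (j + 1) ∣ x).card

theorem truncatedExponent_le (p d : ℕ) (x : ℤ) : truncatedExponent p d x ≤ d := by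
  simpa [truncatedExponent] using
    Finset.card_filter_le (Finset.range d) fun j => (p : ℤ) ^ (j + 1) ∣ x

theorem pow_dvd_iff_le_truncatedExponent {p d k : ℕ} {x : ℤ} (hk : k ≤ d) :
    (p : ℤ) ^ k ∣ x ↔ k ≤ truncatedExponent p d x := by
  constructor
  · intro h
    rw [← Finset.card_range k]
    refine Finset.card_le_card fun j hj => ?_
    have hj := Finset.mem_range.1 hj
    exact Finset.mem_filter.2 ⟨Finset.mem_range.2 (by omega), (pow_dvd_pow _ hj).trans h⟩
  · intro h
    by_contra hx
    have hsub : ((Finset.range d).filter fun j => (p : ℤ) ^ (j + 1) ∣ x) ⊆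
        Finset.range (k - 1) := by
      intro j hj
      obtain ⟨-, hj⟩ := Finset.mem_filter.1 hj
      by_contra hjk
      exact hx ((pow_dvd_pow _ (by simp at hjk; omega)).trans hj)
    have hcard := Finset.card_le_card hsub
    rw [Finset.card_range] at hcard
    have hk0 : k ≠ 0 := by rintro rfl; simp at hx
    unfold truncatedExponent at h
    omega

theorem pow_sum_truncatedExponent_dvd_prod (p d : ℕ) (S : Finset ℤ) (f : ℤ → ℤ) :
    (p : ℤ) ^ ∑ q ∈ S, truncatedExponent p d (f q) ∣ ∏ q ∈ S, f q := by
  rw [← Finset.prod_pow_eq_pow_sum]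
  exact Finset.prod_dvd_prod_of_dvd _ _ fun q _ =>
    (pow_dvd_iff_le_truncatedExponent (truncatedExponent_le p d _)).2 le_rfl

theorem not_pow_succ_sum_truncatedExponent_dvd_prod {p d : ℕ} (hp : p.Prime) {S : Finset ℤ}
    {f : ℤ → ℤ} (hf : ∀ q ∈ S, ¬ (p : ℤ) ^ d ∣ f q) :
    ¬ (p : ℤ) ^ ((∑ q ∈ S, truncatedExponent p d (f q)) + 1) ∣ ∏ q ∈ S, f q := by
  have hp' : Prime (p : ℤ) := Nat.prime_iff_prime_int.1 hp
  have hu : ∀ q, ∃ u, f q = (p : ℤ) ^ truncatedExponent p d (f q) * u := fun q =>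
    (pow_dvd_iff_le_truncatedExponent (truncatedExponent_le p d _)).2 le_rfl
  choose u hu using hu
  intro h
  rw [Finset.prod_congr rfl fun q _ => hu q, Finset.prod_mul_distrib,
    Finset.prod_pow_eq_pow_sum, pow_succ,
    mul_dvd_mul_iff_left (pow_ne_zero _ hp'.ne_zero)] at h
  obtain ⟨q, hq, hdvd⟩ := (hp'.dvd_finsetProd_iff u).1 h
  have hlt : truncatedExponent p d (f q) < d := by
    by_contra hle
    exact hf q hq ((pow_dvd_iff_le_truncatedExponent le_rfl).2 (not_lt.1 hle))
  have hsucc : (p : ℤ) ^ (truncatedExponent p d (f q) + 1) ∣ f q := by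
    have h1 := mul_dvd_mul_left ((p : ℤ) ^ truncatedExponent p d (f q)) hdvd
    rwa [← hu q, ← pow_succ] at h1
  have := (pow_dvd_iff_le_truncatedExponent hlt).1 hsucc
  omega

theorem sum_truncatedExponent_eq_sum_card (p d : ℕ) (S : Finset ℤ) (T : ℤ) :
    ∑ q ∈ S, truncatedExponent p d (T - q) =
      ∑ j ∈ Finset.range d, (S.filter fun q => (p : ℤ) ^ (j + 1) ∣ T - q).card := by
  simp only [truncatedExponent, Finset.card_filter]
  exact Finset.sum_comm

/-- **Covering property of the Alon–Friedland–Kalai polynomial.**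
With `Q'`, `S`, `δ = Σ_{r=0}^{d−1} (p ^ r − 1)` and
`h(T) = (1 / p ^ δ) · Π_{q ∈ S} (T − q)` as in the construction: for every
integer `T`, `p ∣ h(T)` — equivalently `p ^ (δ+1) ∣ Π_{q ∈ S} (T − q)` —
if and only if `T ≡ q (mod p ^ d)` for some `q ∈ S`; in particular `p ∤ h(0)`. -/
theorem afk_polynomial_covering
    (p d : ℕ) (hp : p.Prime) (hd : 1 ≤ d)
    (Q' S : Finset ℤ)
    (hQ0 : (0 : ℤ) ∈ Q')
    (hQdist : ∀ q₁ ∈ Q', ∀ q₂ ∈ Q', q₁ ≠ q₂ → ¬ (p : ℤ) ∣ (q₁ - q₂))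
    (hSinj : ∀ s₁ ∈ S, ∀ s₂ ∈ S, ((s₁ : ZMod (p ^ d)) = (s₂ : ZMod (p ^ d))) → s₁ = s₂)
    (hScompl : ∀ t : ZMod (p ^ d),
      (∃ s ∈ S, (s : ZMod (p ^ d)) = t) ↔ ¬ ∃ q ∈ Q', (q : ZMod (p ^ d)) = t) :
    (∀ T : ℤ,
      ((p : ℤ) ^ ((∑ r ∈ Finset.range d, (p ^ r - 1)) + 1) ∣ ∏ q ∈ S, (T - q)) ↔
        ∃ q ∈ S, (p : ℤ) ^ d ∣ (T - q)) ∧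
    ¬ ((p : ℤ) ^ ((∑ r ∈ Finset.range d, (p ^ r - 1)) + 1) ∣ ∏ q ∈ S, ((0 : ℤ) - q)) := by
  have hcast : ∀ x y : ℤ, (x : ZMod (p ^ d)) = (y : ZMod (p ^ d)) ↔ (p : ℤ) ^ d ∣ y - x := by
    intro x y
    rw [ZMod.intCast_eq_intCast_iff_dvd_sub]
    push_cast
    rfl
  have hpd : ∀ {k : ℕ}, 1 ≤ k → (p : ℤ) ∣ (p : ℤ) ^ k := fun hk => dvd_pow_self _ (by omega)
  have hdisj : Disjoint S Q' := by
    rw [Finset.disjoint_left]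
    exact fun x hxS hxQ => (hScompl x).1 ⟨x, hxS, rfl⟩ ⟨x, hxQ, rfl⟩
  have hR : ∀ x : ℤ, ∃! q, q ∈ S ∪ Q' ∧ (p : ℤ) ^ d ∣ x - q := by
    intro x
    by_cases hx : ∃ q ∈ Q', (q : ZMod (p ^ d)) = x
    · obtain ⟨q, hq, hqx⟩ := hx
      refine ⟨q, ⟨Finset.mem_union_right _ hq, (hcast _ _).1 hqx⟩, ?_⟩
      rintro y ⟨hy, hyx⟩
      have hyx := (hcast _ _).2 hyx
      rcases Finset.mem_union.1 hy with hy | hy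
      · exact absurd ⟨q, hq, hqx⟩ ((hScompl x).1 ⟨y, hy, hyx⟩)
      · by_contra hne
        exact hQdist q hq y hy (Ne.symm hne)
          ((hpd hd).trans ((hcast y q).1 (hyx.trans hqx.symm)))
    · obtain ⟨q, hq, hqx⟩ := (hScompl x).2 hx
      refine ⟨q, ⟨Finset.mem_union_left _ hq, (hcast _ _).1 hqx⟩, ?_⟩
      rintro y ⟨hy, hyx⟩
      have hyx := (hcast _ _).2 hyx
      rcases Finset.mem_union.1 hy with hy | hy
      · exact hSinj y hy q hq (hyx.trans hqx.symm)
      · exact absurd ⟨y, hy, hyx⟩ hx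
  have hcount : ∀ T : ℤ, ∀ j < d,
      (S.filter fun q => (p : ℤ) ^ (j + 1) ∣ T - q).card +
        (Q'.filter fun q => (p : ℤ) ^ (j + 1) ∣ T - q).card = p ^ (d - 1 - j) := by
    intro T j hj
    have hmul : p ^ (j + 1) * p ^ (d - 1 - j) = p ^ d := by
      rw [← pow_add]; congr 1; omega
    have h := card_filter_dvd_sub_of_complete_residues (a := p ^ (j + 1)) (b := p ^ (d - 1 - j))
      (pow_pos hp.pos _) (pow_pos hp.pos _) (R := S ∪ Q')
      (by rw [hmul]; push_cast; exact hR) T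
    push_cast at h
    rwa [Finset.filter_union, Finset.card_union_of_disjoint
      (Finset.disjoint_filter_filter hdisj)] at h
  have hQle : ∀ T : ℤ, ∀ j, (Q'.filter fun q => (p : ℤ) ^ (j + 1) ∣ T - q).card ≤ 1 := by
    intro T j
    refine Finset.card_le_one.2 fun a ha b hb => ?_
    obtain ⟨ha, haT⟩ := Finset.mem_filter.1 ha
    obtain ⟨hb, hbT⟩ := Finset.mem_filter.1 hb
    by_contra hne
    refine hQdist a ha b hb hne ((hpd (Nat.le_add_left 1 j)).trans ?_)
    have := dvd_sub hbT haT
    rwa [sub_sub_sub_cancel_left] at this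
  have hcover : ∀ T : ℤ, (∃ q ∈ S, (p : ℤ) ^ d ∣ T - q) ↔ ¬ ∃ q ∈ Q', (p : ℤ) ^ d ∣ T - q := by
    intro T
    simpa only [hcast] using hScompl T
  have hmain : ∀ T : ℤ,
      ((p : ℤ) ^ ((∑ r ∈ Finset.range d, (p ^ r - 1)) + 1) ∣ ∏ q ∈ S, (T - q)) ↔
        ∃ q ∈ S, (p : ℤ) ^ d ∣ (T - q) := by
    intro T
    have hsum := sum_truncatedExponent_eq_sum_card p d S T
    rw [← Finset.sum_range_reflect (fun r => p ^ r - 1) d]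
    constructor
    · intro h
      by_contra hT
      refine not_pow_succ_sum_truncatedExponent_dvd_prod hp (S := S) (f := fun q => T - q)
        (d := d) (fun q hq hdvd => hT ⟨q, hq, hdvd⟩) ?_
      rw [hsum]
      convert h using 3
      refine Finset.sum_congr rfl fun j hj => ?_
      have hj := Finset.mem_range.1 hj
      obtain ⟨q, hq, hqT⟩ := not_not.1 (mt (hcover T).2 hT)
      have hpos : 0 < (Q'.filter fun q => (p : ℤ) ^ (j + 1) ∣ T - q).card :=
        Finset.card_pos.2 ⟨q, Finset.mem_filter.2 ⟨hq, (pow_dvd_pow _ hj).trans hqT⟩⟩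
      have h1 := hQle T j
      have h2 := hcount T j hj
      omega
    · intro hT
      refine (pow_dvd_pow _ ?_).trans
        (pow_sum_truncatedExponent_dvd_prod p d S fun q => T - q)
      rw [hsum, Nat.add_one_le_iff]
      refine Finset.sum_lt_sum (fun j hj => ?_) ⟨d - 1, Finset.mem_range.2 (by omega), ?_⟩
      · have h1 := hQle T j
        have h2 := hcount T j (Finset.mem_range.1 hj)
        omega
      · obtain ⟨q, hq, hqT⟩ := hT
        have hpos : 0 < (S.filter fun q => (p : ℤ) ^ (d - 1 + 1) ∣ T - q).card :=
          Finset.card_pos.2 ⟨q, Finset.mem_filter.2 ⟨hq, by rwa [Nat.sub_add_cancel hd]⟩⟩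
        simpa using hpos
  exact ⟨hmain, fun h => (hcover 0).1 ((hmain 0).1 h) ⟨0, hQ0, by simp⟩⟩
end

section
/- Let p be a prime, d ≥ 1, and let Q ⊆ ℤ/p^dℤ be a set containing 0. Then price((ℤ/p^dℤ) \ Q) ≤ p^d − card_p(Q). -/
section IntegerValuedCover

open Polynomial

/-- The polynomial `x ↦ x.choose j` over `ℚ`. -/
noncomputable def binomialPoly (j : ℕ) : ℚ[X] :=
  C ((j.factorial : ℚ)⁻¹) * descPochhammer ℚ j

theorem factorial_mul_choose_int (n : ℤ) (k : ℕ) :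
    (k.factorial : ℤ) * Ring.choose n k = (descPochhammer ℤ k).eval n := by
  have h := Ring.descPochhammer_eq_factorial_smul_choose n k
  rw [nsmul_eq_mul] at h
  rw [← h, eval_eq_smeval]

theorem eval_binomialPoly (j : ℕ) (b : ℤ) :
    (binomialPoly j).eval (b : ℚ) = (Ring.choose b j : ℤ) := by
  have h : ((j.factorial : ℤ) * Ring.choose b j : ℚ) = (descPochhammer ℚ j).eval (b : ℚ) := by
    rw [← descPochhammer_map (Int.castRingHom ℚ) j, ← eq_intCast (Int.castRingHom ℚ) b,
      eval_map_apply, ← factorial_mul_choose_int]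
    simp
  have hj : (j.factorial : ℚ) ≠ 0 := by exact_mod_cast j.factorial_ne_zero
  rw [binomialPoly, eval_mul, eval_C, ← h]
  push_cast
  field_simp

theorem natDegree_binomialPoly_le (j : ℕ) : (binomialPoly j).natDegree ≤ j :=
  (natDegree_C_mul_le _ _).trans (descPochhammer_natDegree ℚ j).le

/-- There is a polynomial with given integer coefficients in the binomial basis. -/
theorem exists_poly_eval_eq_sum_choose (a : ℕ → ℤ) (M : ℕ) :
    ∃ f : ℚ[X], f.natDegree ≤ M ∧
      ∀ b : ℤ, f.eval (b : ℚ) = (∑ j ∈ Finset.range (M + 1), a j * Ring.choose b j : ℤ) := by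
  refine ⟨∑ j ∈ Finset.range (M + 1), C (a j : ℚ) * binomialPoly j, ?_, fun b => ?_⟩
  · refine natDegree_sum_le_of_forall_le _ _ fun j hj => ?_
    exact (natDegree_C_mul_le _ _).trans
      ((natDegree_binomialPoly_le j).trans (Finset.mem_range_succ_iff.mp hj))
  · simp [eval_finsetSum, eval_binomialPoly]

theorem dvd_choose_of_not_dvd_add_one {p d : ℕ} (hp : p.Prime) {n : ℤ}
    (h : ¬ ((p ^ d : ℕ) : ℤ) ∣ n + 1) : (p : ℤ) ∣ Ring.choose n (p ^ d - 1) := by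
  by_contra hc
  refine h ?_
  have hN : 1 ≤ p ^ d := Nat.one_le_pow _ _ hp.pos
  have key := Ring.choose_smul_choose (n + 1) hN
  rw [Nat.choose_one_right, Ring.choose_one_right, nsmul_eq_mul, Nat.cast_one,
    add_sub_cancel_right] at key
  have hcop : IsCoprime ((p ^ d : ℕ) : ℤ) (Ring.choose n (p ^ d - 1)) := by
    rw [Nat.cast_pow]
    exact ((Nat.prime_iff_prime_int.mp hp).coprime_iff_not_dvd.mpr hc).pow_left
  exact hcop.dvd_of_dvd_mul_right (Dvd.intro _ key)

theorem choose_neg_one_int (k : ℕ) : Ring.choose (-1 : ℤ) k = (-1) ^ k := by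
  induction k with
  | zero => simp
  | succ k ih =>
    have h := Ring.choose_succ_succ (-1 : ℤ) k
    rw [neg_add_cancel, Ring.choose_zero_succ] at h
    rw [pow_succ, ← ih]
    linarith

/-- Divided differences of order `#s - 1` kill polynomials of smaller degree. -/
theorem sum_nodalWeight_mul_eval_eq_zero {F : Type*} [Field F] [DecidableEq F] (s : Finset F)
    (P : F[X]) (hP : P.natDegree + 1 < s.card) :
    ∑ r ∈ s, Lagrange.nodalWeight s id r * P.eval r = 0 := by
  have hdeg : P.degree < s.card :=
    degree_le_natDegree.trans_lt (by exact_mod_cast (by lia : P.natDegree < s.card))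
  have h := Lagrange.coeff_eq_sum (s := s) (v := id) Function.injective_id.injOn hdeg
  rw [coeff_eq_zero_of_natDegree_lt (by lia)] at h
  rw [h]
  refine Finset.sum_congr rfl fun r _ => ?_
  rw [Lagrange.nodalWeight, Finset.prod_inv_distrib, div_eq_mul_inv, mul_comm]
  rfl

theorem dvd_sum_mul_choose {p : ℕ} [Fact p.Prime] (s : Finset (ZMod p)) (c q : ZMod p → ℤ)
    (hc : ∀ r ∈ s, (c r : ZMod p) = Lagrange.nodalWeight s id r)
    (hq : ∀ r ∈ s, (q r : ZMod p) = r) {k : ℕ} (hk : k + 1 < s.card) :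
    (p : ℤ) ∣ ∑ r ∈ s, c r * Ring.choose (-q r - 1) k := by
  have hkp : k < p := by
    have := s.card_le_univ
    rw [ZMod.card] at this
    lia
  have hfac : ((k.factorial : ℕ) : ZMod p) ≠ 0 := by
    rw [Ne, ZMod.natCast_eq_zero_iff, (Fact.out : p.Prime).dvd_factorial]
    lia
  rw [← ZMod.intCast_zmod_eq_zero_iff_dvd]
  refine (mul_eq_zero.mp ?_).resolve_left hfac
  rw [← sum_nodalWeight_mul_eval_eq_zero s ((descPochhammer (ZMod p) k).comp (-X - 1)) ?_]
  · rw [Int.cast_sum, Finset.mul_sum]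
    refine Finset.sum_congr rfl fun r hr => ?_
    have h : ((k.factorial : ℕ) : ZMod p) * ((Ring.choose (-q r - 1) k : ℤ) : ZMod p) =
        (descPochhammer (ZMod p) k).eval (-r - 1) := by
      have h2 := congrArg (Int.cast : ℤ → ZMod p) (factorial_mul_choose_int (-q r - 1) k)
      rw [← descPochhammer_map (Int.castRingHom (ZMod p)) k]
      have h3 : (-r - 1 : ZMod p) = Int.castRingHom (ZMod p) (-q r - 1) := by
        simp [hq r hr]
      rw [h3, eval_map_apply]
      simpa using h2
    rw [Int.cast_mul, hc r hr, mul_left_comm, h]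
    simp
  · have h1 : ((-X - 1 : (ZMod p)[X])).natDegree ≤ 1 := by compute_degree
    have h2 := natDegree_comp_le (p := descPochhammer (ZMod p) k) (q := (-X - 1 : (ZMod p)[X]))
    rw [descPochhammer_natDegree] at h2
    nlinarith

/-- A polynomial of degree at most `p ^ d - #s` agreeing modulo `p` with a combination of the
point indicators `x ↦ (x - q - 1).choose (p ^ d - 1)`. -/
theorem exists_poly_modEq_sum_choose {p d : ℕ} [Fact p.Prime] (s : Finset (ZMod p))
    (hs : s.Nonempty) (c q : ZMod p → ℤ)
    (hc : ∀ r ∈ s, (c r : ZMod p) = Lagrange.nodalWeight s id r)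
    (hq : ∀ r ∈ s, (q r : ZMod p) = r) :
    ∃ f : ℚ[X], f.natDegree ≤ p ^ d - s.card ∧
      ∀ b : ℤ, ∃ z : ℤ, f.eval (b : ℚ) = z ∧
        z ≡ ∑ r ∈ s, c r * Ring.choose (b - q r - 1) (p ^ d - 1) [ZMOD p] := by
  have hN : 1 ≤ p ^ d := Nat.one_le_pow _ _ (Fact.out : p.Prime).pos
  have hm : 1 ≤ s.card := hs.card_pos
  obtain ⟨f, hf, hfe⟩ := exists_poly_eval_eq_sum_choose
    (fun j => ∑ r ∈ s, c r * Ring.choose (-q r - 1) (p ^ d - 1 - j)) (p ^ d - s.card)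
  refine ⟨f, hf, fun b => ⟨_, hfe b, ?_⟩⟩
  have hvand : ∑ r ∈ s, c r * Ring.choose (b - q r - 1) (p ^ d - 1) =
      ∑ j ∈ Finset.range (p ^ d),
        (∑ r ∈ s, c r * Ring.choose (-q r - 1) (p ^ d - 1 - j)) * Ring.choose b j := by
    simp_rw [Finset.sum_mul]
    rw [Finset.sum_comm]
    refine Finset.sum_congr rfl fun r _ => ?_
    have h : b - q r - 1 = b + (-q r - 1) := by ring
    rw [h, Ring.add_choose_eq _ (Commute.all _ _),
      Finset.Nat.sum_antidiagonal_eq_sum_range_succ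
        (fun i j => Ring.choose b i * Ring.choose (-q r - 1) j), Nat.succ_eq_add_one,
      Nat.sub_add_cancel hN, Finset.mul_sum]
    exact Finset.sum_congr rfl fun j _ => by ring
  rw [hvand, Int.modEq_iff_dvd,
    ← Finset.sum_range_add_sum_Ico _ (by lia : p ^ d - s.card + 1 ≤ p ^ d), add_sub_cancel_left]
  refine Finset.dvd_sum fun j hj => Dvd.dvd.mul_right ?_ _
  rw [Finset.mem_Ico] at hj
  exact dvd_sum_mul_choose s c q hc hq (by lia)

theorem card_image_natCast_val {p N : ℕ} [NeZero p] (Q : Finset (ZMod N)) :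
    (Q.image fun x => (x.val : ZMod p)).card = cardp p Q := by
  rw [cardp, ← Finset.card_image_of_injective _ (ZMod.val_injective p), Finset.image_image]
  congr 2
  funext x
  exact ZMod.val_natCast p x.val

end IntegerValuedCover

/-- For `0 ∈ Q ⊆ ℤ/p^dℤ` one has `price((ℤ/p^dℤ) \ Q) ≤ p ^ d − card_p Q`. -/
theorem price_le_afk_bound (p d : ℕ) (hp : p.Prime) (hd : 1 ≤ d)
    (Q : Finset (ZMod (p ^ d))) (hQ0 : (0 : ZMod (p ^ d)) ∈ Q) :
    price p d (↑Q)ᶜ ≤ p ^ d - cardp p Q := by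
  have : Fact p.Prime := ⟨hp⟩
  set s : Finset (ZMod p) := Q.image fun x => (x.val : ZMod p) with hsdef
  have h0s : (0 : ZMod p) ∈ s := Finset.mem_image.mpr ⟨0, hQ0, by simp⟩
  have hrep : ∀ r : ZMod p, ∃ q : ℤ,
      r ∈ s → (q : ZMod (p ^ d)) ∈ Q ∧ (q : ZMod p) = r ∧ (r = 0 → q = 0) := by
    intro r
    by_cases hr0 : r = 0
    · exact ⟨0, fun _ => ⟨by simpa using hQ0, by simp [hr0], fun _ => rfl⟩⟩
    by_cases hr : r ∈ s
    · obtain ⟨x, hx, hxr⟩ := Finset.mem_image.mp hr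
      exact ⟨x.val, fun _ => ⟨by simpa using hx, by simpa using hxr, fun h => absurd h hr0⟩⟩
    · exact ⟨0, fun h => absurd h hr⟩
  choose q hq using hrep
  have hcast (r : ZMod p) (hr : r ∈ s) : (q r : ZMod p) = r := (hq r hr).2.1
  let c : ZMod p → ℤ := fun r => (Lagrange.nodalWeight s id r).val
  have hc : ∀ r ∈ s, (c r : ZMod p) = Lagrange.nodalWeight s id r := by
    intro r _
    simp [c]
  obtain ⟨f, hdeg, hf⟩ := exists_poly_modEq_sum_choose (d := d) s ⟨0, h0s⟩ c q hc hcast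
  rw [← card_image_natCast_val]
  suffices hcov : CoversSet p d {f} (↑Q)ᶜ by
    refine le_trans ?_ hdeg
    unfold price
    exact Nat.sInf_le ⟨{f}, hcov, (Finset.sum_singleton Polynomial.natDegree f).symm⟩
  refine ⟨?_, ?_, ?_⟩
  · intro h hh t
    rw [Finset.mem_singleton.mp hh]
    obtain ⟨z, hz, -⟩ := hf t
    exact ⟨z, hz⟩
  · intro h hh z hz hdvd
    rw [Finset.mem_singleton.mp hh] at hz
    obtain ⟨z', hz', hmod⟩ := hf 0
    rw [Int.cast_zero, hz, Int.cast_inj] at hz'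
    subst hz'
    have hsum := (hmod.dvd_iff).mp hdvd
    rw [← Finset.add_sum_erase _ _ h0s, (hq 0 h0s).2.2 rfl] at hsum
    have hrest : (p : ℤ) ∣
        ∑ r ∈ s.erase 0, c r * Ring.choose (0 - q r - 1) (p ^ d - 1) := by
      refine Finset.dvd_sum fun r hr => Dvd.dvd.mul_left ?_ _
      obtain ⟨hr0, hrs⟩ := Finset.mem_erase.mp hr
      refine dvd_choose_of_not_dvd_add_one hp fun hdvd' => hr0 ?_
      rw [← hcast r hrs, ZMod.intCast_zmod_eq_zero_iff_dvd]
      have hpN : (p : ℤ) ∣ ((p ^ d : ℕ) : ℤ) := by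
        exact_mod_cast dvd_pow_self p (by lia)
      simpa using hpN.trans hdvd'
    have hfirst := (dvd_add_left hrest).mp hsum
    rw [sub_zero, zero_sub, choose_neg_one_int, ← ZMod.intCast_zmod_eq_zero_iff_dvd, Int.cast_mul,
      hc 0 h0s] at hfirst
    have hw := Lagrange.nodalWeight_ne_zero (s := s) (v := id) Function.injective_id.injOn h0s
    simp [hw] at hfirst
  · intro b hb
    obtain ⟨z, hz, hmod⟩ := hf b
    refine ⟨f, Finset.mem_singleton_self f, z, hz, hmod.dvd_iff.mpr ?_⟩
    refine Finset.dvd_sum fun r hr => Dvd.dvd.mul_left ?_ _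
    refine dvd_choose_of_not_dvd_add_one hp fun hdvd => hb ?_
    rw [sub_add_cancel, ← ZMod.intCast_zmod_eq_zero_iff_dvd, Int.cast_sub, sub_eq_zero] at hdvd
    rw [hdvd]
    exact (hq r hr).1
end

section
/- Let p be a prime, d ≥ 1, and let B ⊆ ℤ/p^dℤ be a set not containing 0. Then price(B) ≤ κ(B). -/
/-- The quantity `κ` of the paper, defined recursively. The set `B ⊆ ℤ/p^dℤ`
is represented by the set of values of its elements, a finite set of naturals
in `[0, p ^ d)`. For `d ≤ 1`, `κ(B) = |B|`. For `d > 1`, with `k` the number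
of elements of `B` divisible by `p ^ (d−1)` and `B̂ ⊆ ℤ/p^{d−1}ℤ` the set of
residues modulo `p ^ (d−1)` attained by more than `k` elements of `B`,
`κ(B) = k · p ^ (d−1) + κ(B̂)`. -/
def kappa (p : ℕ) : ℕ → Finset ℕ → ℕ
  | 0, B => B.card
  | 1, B => B.card
  | d + 2, B =>
      (B.filter fun b => p ^ (d + 1) ∣ b).card * p ^ (d + 1) +
        kappa p (d + 1)
          ((Finset.range (p ^ (d + 1))).filter fun c =>
            (B.filter fun b => p ^ (d + 1) ∣ b).card <
              (B.filter fun b => b % p ^ (d + 1) = c).card)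

open Polynomial in
/-- If `S` avoids `0` modulo `p ^ (n + 1)` and meets every residue class modulo `p ^ n` in exactly
`k` elements, then a single integer-valued polynomial of degree `#S`, a constant multiple of
`∏ s ∈ S, (X - s)`, covers `S`. -/
theorem exists_coversSet_singleton_of_equidistributed {p n k : ℕ} (hp : p.Prime) (S : Finset ℕ)
    (hS : ∀ s ∈ S, ¬ p ^ (n + 1) ∣ s)
    (hcard : ∀ c : ZMod (p ^ n), (S.filter fun s : ℕ => (s : ZMod (p ^ n)) = c).card = k) :
    ∃ h : ℚ[X], CoversSet p (n + 1) {h} ((fun s : ℕ => (s : ZMod (p ^ (n + 1)))) '' ↑S) ∧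
      h.natDegree = k * p ^ n := by
  have : NeZero (p ^ n) := ⟨pow_ne_zero _ hp.ne_zero⟩
  have hpZ : Prime (p : ℤ) := Nat.prime_iff_prime_int.mp hp
  set φ : ZMod (p ^ n) → ℕ := fun y => Nat.gcd y.val (p ^ n) with hφ
  have hφpos (y) : 0 < φ y := Nat.gcd_pos_of_pos_right _ (pow_pos hp.pos _)
  have hφcast (t : ℤ) : φ (t : ZMod (p ^ n)) = Int.gcd t (p ^ n : ℕ) := by
    rw [hφ]
    dsimp only
    rw [← Int.gcd_natCast_natCast, ZMod.val_intCast, Int.gcd_emod]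
  have hφdvd (t : ℤ) : (φ (t : ZMod (p ^ n)) : ℤ) ∣ t := by
    rw [hφcast]; exact Int.gcd_dvd_left ..
  set M : ℕ := (∏ c, φ c) ^ k with hM
  have hMpos : 0 < M := pow_pos (Finset.prod_pos fun c _ => hφpos c) _
  have hMprod (t : ℤ) : ∏ s ∈ S, φ ((t - s : ℤ) : ZMod (p ^ n)) = M := by
    rw [← Finset.prod_fiberwise_of_maps_to (g := fun s : ℕ => (s : ZMod (p ^ n)))
      (t := Finset.univ) (by simp), hM, ← Finset.prod_pow,
      ← Equiv.prod_comp (Equiv.subLeft (t : ZMod (p ^ n))) fun c => φ c ^ k]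
    refine Finset.prod_congr rfl fun c _ => ?_
    rw [Finset.prod_congr rfl (g := fun _ => φ ((t : ZMod (p ^ n)) - c)), Finset.prod_const, hcard]
    · rfl
    · intro s hs
      rw [Int.cast_sub, Int.cast_natCast, (Finset.mem_filter.mp hs).2]
  set q : ℤ → ℕ → ℤ := fun t s => (t - s) / φ ((t - s : ℤ) : ZMod (p ^ n)) with hq
  have hqmul (t : ℤ) (s : ℕ) : (φ ((t - s : ℤ) : ZMod (p ^ n)) : ℤ) * q t s = t - s :=
    Int.mul_ediv_cancel' (hφdvd _)
  set h : ℚ[X] := C (M : ℚ)⁻¹ * ∏ s ∈ S, (X - C (s : ℚ)) with hh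
  have heval (t : ℤ) : h.eval (t : ℚ) = ((∏ s ∈ S, q t s : ℤ) : ℚ) := by
    have h1 : (M : ℤ) * ∏ s ∈ S, q t s = ∏ s ∈ S, (t - s) := by
      rw [← hMprod t]
      push_cast
      rw [← Finset.prod_mul_distrib]
      refine Finset.prod_congr rfl fun s _ => ?_
      have := hqmul t s
      push_cast at this
      exact this
    have h2 : (M : ℚ) * ((∏ s ∈ S, q t s : ℤ) : ℚ) = ∏ s ∈ S, ((t : ℚ) - s) := by
      exact_mod_cast congrArg (Int.cast : ℤ → ℚ) h1
    have hM0 : (M : ℚ) ≠ 0 := by exact_mod_cast hMpos.ne'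
    rw [hh, eval_mul, eval_C, eval_prod]
    simp only [eval_sub, eval_X, eval_C]
    rw [← h2, inv_mul_cancel_left₀ hM0]
  have hqzero (s : ℕ) (hs : s ∈ S) : ¬ (p : ℤ) ∣ q 0 s := by
    intro hdvd
    have hmul := hqmul 0 s
    rw [hφcast] at hmul
    have hgcd : Int.gcd (0 - (s : ℤ)) (p ^ n : ℕ) = Nat.gcd s (p ^ n) := by
      rw [zero_sub, Int.neg_gcd, Int.gcd_natCast_natCast]
    rw [hgcd] at hmul
    have hps : Nat.gcd s (p ^ n) * p ∣ s := by
      have : ((Nat.gcd s (p ^ n) : ℕ) : ℤ) * p ∣ 0 - (s : ℤ) := hmul ▸ mul_dvd_mul_left _ hdvd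
      rw [zero_sub, dvd_neg] at this
      exact_mod_cast this
    obtain ⟨i, hi, hgi⟩ := (Nat.dvd_prime_pow hp).mp (Nat.gcd_dvd_right s (p ^ n))
    rw [hgi, ← pow_succ] at hps
    rcases hi.eq_or_lt with rfl | hlt
    · exact hS s hs hps
    · have := Nat.dvd_gcd hps (pow_dvd_pow p (Nat.succ_le_of_lt hlt))
      rw [hgi, Nat.pow_dvd_pow_iff_le_right hp.one_lt] at this
      omega
  refine ⟨h, ⟨?_, ?_, ?_⟩, ?_⟩
  · rintro _ hmem t
    rw [Finset.mem_singleton.mp hmem]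
    exact ⟨_, heval t⟩
  · rintro _ hmem z hz hdvd
    rw [Finset.mem_singleton.mp hmem] at hz
    have h0 := heval 0
    rw [Int.cast_zero, hz, Int.cast_inj] at h0
    obtain ⟨s, hs, hps⟩ := (hpZ.dvd_finsetProd_iff _).mp (h0 ▸ hdvd)
    exact hqzero s hs hps
  · rintro b ⟨s, hs, hsb⟩
    refine ⟨h, Finset.mem_singleton_self h, _, heval b, dvd_trans ?_ (Finset.dvd_prod_of_mem _ hs)⟩
    have hdvd : ((p ^ (n + 1) : ℕ) : ℤ) ∣ b - s := by
      rw [← ZMod.intCast_eq_intCast_iff_dvd_sub]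
      exact_mod_cast hsb
    have hg : Int.gcd (b - s) (p ^ n : ℕ) = p ^ n := by
      have : ((p ^ n : ℕ) : ℤ) ∣ b - s :=
        (Int.natCast_dvd_natCast.mpr (pow_dvd_pow p n.le_succ)).trans hdvd
      rw [Int.gcd_eq_natAbs_right this, Int.natAbs_natCast]
    rw [← hqmul b s, hφcast, hg, pow_succ, Nat.cast_mul] at hdvd
    exact (mul_dvd_mul_iff_left (by exact_mod_cast (pow_pos hp.pos n).ne')).mp hdvd
  · rw [hh, natDegree_C_mul (inv_ne_zero (by exact_mod_cast hMpos.ne')),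
      natDegree_finsetProd_X_sub_C_eq_card,
      Finset.card_eq_sum_card_fiberwise (f := fun s : ℕ => (s : ZMod (p ^ n)))
        (t := Finset.univ) (by simp), Finset.sum_congr rfl fun c _ => hcard c]
    simp [ZMod.card, mul_comm]

/-- A set of naturals without multiples of `p ^ (n + 1)` extends, when its intersections with the
residue classes modulo `p ^ n` have at most `k < p` elements, to one for which they have exactly
`k` elements. -/
theorem exists_equidistributed_superset {p n k : ℕ} (hp : p.Prime) (hk : k < p) (B : Finset ℕ)
    (hB : ∀ b ∈ B, ¬ p ^ (n + 1) ∣ b)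
    (hcard : ∀ c : ZMod (p ^ n), (B.filter fun s : ℕ => (s : ZMod (p ^ n)) = c).card ≤ k) :
    ∃ S : Finset ℕ, B ⊆ S ∧ (∀ s ∈ S, ¬ p ^ (n + 1) ∣ s) ∧
      ∀ c : ZMod (p ^ n), (S.filter fun s : ℕ => (s : ZMod (p ^ n)) = c).card = k := by
  have : NeZero (p ^ n) := ⟨pow_ne_zero _ hp.ne_zero⟩
  have hpn : 0 < p ^ n := pow_pos hp.pos n
  have key (c : ZMod (p ^ n)) : ∃ U : Finset ℕ, (B.filter fun s : ℕ => (s : ZMod (p ^ n)) = c) ⊆ U ∧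
      (∀ s ∈ U, (s : ZMod (p ^ n)) = c ∧ ¬ p ^ (n + 1) ∣ s) ∧ U.card = k := by
    set f : ℕ → ℕ := fun i => c.val + i * p ^ n with hf
    have hfinj : Function.Injective f := fun i j hij => by
      simpa [hf, hpn.ne', hp.ne_zero] using hij
    set T := (B.filter fun s : ℕ => (s : ZMod (p ^ n)) = c) ∪ (Finset.Ico 1 p).image f with hT
    have hTcard : k ≤ T.card := by
      calc k ≤ ((Finset.Ico 1 p).image f).card := by
            rw [Finset.card_image_of_injective _ hfinj, Nat.card_Ico]; omega
        _ ≤ T.card := Finset.card_le_card Finset.subset_union_right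
    obtain ⟨U, hBU, hUT, hU⟩ :=
      Finset.exists_subsuperset_card_eq Finset.subset_union_left (hcard c) hTcard
    refine ⟨U, hBU, fun s hs => ?_, hU⟩
    rcases Finset.mem_union.mp (hUT hs) with hs | hs
    · rw [Finset.mem_filter] at hs
      exact ⟨hs.2, hB s hs.1⟩
    · obtain ⟨i, hi, rfl⟩ := Finset.mem_image.mp hs
      rw [Finset.mem_Ico] at hi
      refine ⟨by simp [hf], ?_⟩
      refine Nat.not_dvd_of_pos_of_lt (Nat.add_pos_right _ (Nat.mul_pos hi.1 hpn)) ?_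
      calc c.val + i * p ^ n < (i + 1) * p ^ n := by have := ZMod.val_lt c; linarith
        _ ≤ p ^ (n + 1) := by rw [pow_succ']; exact Nat.mul_le_mul_right _ hi.2
  choose U hBU hU hUcard using key
  refine ⟨Finset.univ.biUnion U, fun b hb => ?_, fun s hs => ?_, fun c => ?_⟩
  · exact Finset.mem_biUnion.mpr ⟨b, Finset.mem_univ _, hBU _ (Finset.mem_filter.mpr ⟨hb, rfl⟩)⟩
  · obtain ⟨c, -, hs⟩ := Finset.mem_biUnion.mp hs
    exact (hU c s hs).2
  · rw [← hUcard c]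
    congr 1
    ext s
    simp only [Finset.mem_filter, Finset.mem_biUnion, Finset.mem_univ, true_and]
    constructor
    · rintro ⟨⟨c', hs⟩, hc⟩
      rwa [← hc, (hU c' s hs).1]
    · exact fun hs => ⟨⟨c, hs⟩, (hU c s hs).1⟩

/-- A set of naturals below `p ^ (d + 1)` avoiding `0` is covered at cost at most its `kappa`. -/
theorem exists_coversSet_sum_natDegree_le_kappa {p : ℕ} (hp : p.Prime) (d : ℕ) (B : Finset ℕ)
    (hlt : ∀ b ∈ B, b < p ^ (d + 1)) (h0 : 0 ∉ B) :
    ∃ H : Finset (Polynomial ℚ),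
      CoversSet p (d + 1) H ((fun s : ℕ => (s : ZMod (p ^ (d + 1)))) '' ↑B) ∧
      ∑ h ∈ H, h.natDegree ≤ kappa p (d + 1) B := by
  classical
  have hndvd : ∀ b ∈ B, ¬ p ^ (d + 1) ∣ b := fun b hb =>
    Nat.not_dvd_of_pos_of_lt (Nat.pos_of_ne_zero fun h => h0 (h ▸ hb)) (hlt b hb)
  induction d generalizing B with
  | zero =>
    obtain ⟨h, hcov, hdeg⟩ := exists_coversSet_singleton_of_equidistributed (n := 0) (k := B.card)
      hp B hndvd (fun c => by
        have : Subsingleton (ZMod (p ^ 0)) := by rw [pow_zero]; infer_instance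
        rw [Finset.filter_true_of_mem fun s _ => Subsingleton.elim _ _])
    exact ⟨{h}, hcov, by simp [hdeg, kappa]⟩
  | succ d ih =>
    set k := (B.filter fun b => p ^ (d + 1) ∣ b).card with hk
    set R := (Finset.range (p ^ (d + 1))).filter fun c =>
      k < (B.filter fun b => b % p ^ (d + 1) = c).card with hR
    have hpd : 0 < p ^ (d + 1) := pow_pos hp.pos _
    have hkp : k < p := by
      have hsub : (B.filter fun b => p ^ (d + 1) ∣ b) ⊆
          (Finset.Ico 1 p).image fun i => p ^ (d + 1) * i := by
        intro b hb
        obtain ⟨hb, i, rfl⟩ := Finset.mem_filter.mp hb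
        refine Finset.mem_image.mpr ⟨i, Finset.mem_Ico.mpr ⟨?_, ?_⟩, rfl⟩
        · exact Nat.pos_of_ne_zero fun hi => h0 (by simpa [hi] using hb)
        · have := hlt _ hb
          rw [pow_succ p (d + 1)] at this
          exact Nat.lt_of_mul_lt_mul_left this
      have := (Finset.card_le_card hsub).trans Finset.card_image_le
      rw [Nat.card_Ico, ← hk] at this
      have := hp.pos
      omega
    have hR0 : 0 ∉ R := by
      rw [hR, Finset.mem_filter]
      rintro ⟨-, hlt'⟩
      simp only [← Nat.dvd_iff_mod_eq_zero, ← hk, lt_self_iff_false] at hlt'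
    have hRlt : ∀ c ∈ R, c < p ^ (d + 1) := fun c hc =>
      Finset.mem_range.mp (Finset.mem_filter.mp hc).1
    obtain ⟨H, ⟨hH1, hH2, hH3⟩, hHdeg⟩ := ih R hRlt hR0 fun c hc =>
      Nat.not_dvd_of_pos_of_lt (Nat.pos_of_ne_zero fun h => hR0 (h ▸ hc)) (hRlt c hc)
    have : NeZero (p ^ (d + 1)) := ⟨hpd.ne'⟩
    obtain ⟨S, hBS, hS, hScard⟩ := exists_equidistributed_superset (n := d + 1) hp hkp
      (B.filter fun b => b % p ^ (d + 1) ∉ R) (fun b hb => hndvd b (Finset.mem_filter.mp hb).1)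
      (fun c => by
        by_cases hc : c.val ∈ R
        · rw [Finset.filter_filter, Finset.filter_false_of_mem, Finset.card_empty]
          · exact Nat.zero_le _
          rintro b - ⟨hb, rfl⟩
          rw [ZMod.val_natCast] at hc
          exact hb hc
        · have hc' : (B.filter fun b => b % p ^ (d + 1) = c.val).card ≤ k := by
            by_contra! hlt'
            exact hc (Finset.mem_filter.mpr ⟨Finset.mem_range.mpr (ZMod.val_lt c), hlt'⟩)
          refine (Finset.card_le_card fun b hb => ?_).trans hc'
          simp only [Finset.mem_filter] at hb ⊢
          exact ⟨hb.1.1, by rw [← hb.2, ZMod.val_natCast]⟩)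
    obtain ⟨h, ⟨hh1, hh2, hh3⟩, hdeg⟩ :=
      exists_coversSet_singleton_of_equidistributed hp S hS hScard
    refine ⟨{h} ∪ H, ⟨?_, ?_, ?_⟩, ?_⟩
    · exact fun g hg => (Finset.mem_union.mp hg).elim (hh1 g) (hH1 g)
    · exact fun g hg => (Finset.mem_union.mp hg).elim (hh2 g) (hH2 g)
    · rintro b ⟨s, hs, hsb⟩
      by_cases hsR : s % p ^ (d + 1) ∈ R
      · obtain ⟨g, hg, hz⟩ := hH3 b ⟨s % p ^ (d + 1), hsR, by
          have := congrArg (ZMod.castHom (pow_dvd_pow p (Nat.le_succ (d + 1))) (ZMod (p ^ (d + 1))))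
            hsb
          rw [map_natCast, map_intCast] at this
          rw [← this]
          exact ZMod.natCast_mod s _⟩
        exact ⟨g, Finset.mem_union_right _ hg, hz⟩
      · obtain ⟨g, hg, hz⟩ := hh3 b ⟨s, hBS (Finset.mem_filter.mpr ⟨hs, hsR⟩), hsb⟩
        exact ⟨g, Finset.mem_union_left _ hg, hz⟩
    · calc ∑ g ∈ {h} ∪ H, g.natDegree ≤ ∑ g ∈ {h}, g.natDegree + ∑ g ∈ H, g.natDegree := by
            rw [← Finset.sum_union_inter]; exact Nat.le_add_right _ _
        _ ≤ k * p ^ (d + 1) + kappa p (d + 1) R := by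
            rw [Finset.sum_singleton, hdeg]; exact Nat.add_le_add_left hHdeg _

/-- **`price` is bounded by `κ`.** For any `B ⊆ ℤ/p^dℤ` not containing `0`,
`price(B) ≤ κ(B)` (where `B` is passed to `κ` via the values of its elements). -/
theorem price_le_kappa (p d : ℕ) (hp : p.Prime) (hd : 1 ≤ d)
    (B : Finset (ZMod (p ^ d))) (h0 : (0 : ZMod (p ^ d)) ∉ B) :
    price p d ↑B ≤ kappa p d (B.image ZMod.val) := by
  obtain ⟨d, rfl⟩ := Nat.exists_eq_add_of_le' hd
  have : NeZero (p ^ (d + 1)) := ⟨pow_ne_zero _ hp.ne_zero⟩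
  obtain ⟨H, hcov, hsum⟩ := exists_coversSet_sum_natDegree_le_kappa hp d (B.image ZMod.val)
    (fun b hb => by
      obtain ⟨x, -, rfl⟩ := Finset.mem_image.mp hb
      exact ZMod.val_lt x)
    (fun hb => by
      obtain ⟨x, hx, hx0⟩ := Finset.mem_image.mp hb
      exact h0 ((ZMod.val_eq_zero x).mp hx0 ▸ hx))
  have himage : (fun s : ℕ => (s : ZMod (p ^ (d + 1)))) '' ↑(B.image ZMod.val) = ↑B := by
    simp [Set.image_image]
  rw [himage] at hcov
  exact le_trans (Nat.sInf_le ⟨H, hcov, rfl⟩) hsum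
end

section
/- Let p be a prime, r ≥ 0, and let q_1, q_2, …, q_{p^r} be integers forming a complete residue system modulo p^r. Set δ = Σ_{j=0}^{r−1} p^j. Then for every integer T, the product ∏_{i=1}^{p^r} (T − q_i) is divisible by p^δ; hence h(T) = (1/p^δ)·∏_{i=1}^{p^r} (T − q_i) is an integer-valued polynomial of degree p^r. -/
/-- An integer is divisible by `b` raised to the number of exponents `j ∈ [1, r]` for which
`b ^ j` divides it. -/
theorem pow_card_filter_pow_dvd (b x : ℤ) (r : ℕ) :
    b ^ ((Finset.range r).filter fun j => b ^ (j + 1) ∣ x).card ∣ x := by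
  rcases ((Finset.range r).filter fun j => b ^ (j + 1) ∣ x).eq_empty_or_nonempty with h | h
  · simp [h]
  · have hm := Finset.max'_mem _ h
    refine (pow_dvd_pow b ?_).trans (Finset.mem_filter.1 hm).2
    refine (Finset.card_le_card fun j hj => ?_).trans_eq (Finset.card_range _)
    exact Finset.mem_range.2 (Nat.lt_succ_of_le (Finset.le_max' _ j hj))

/-- Counting the prime-power divisors of the factors of a product level by level. -/
theorem pow_sum_card_filter_dvd_prod_s11 {ι : Type*} [Fintype ι] (b : ℤ) (f : ι → ℤ) (r : ℕ) :
    b ^ (∑ j ∈ Finset.range r, (Finset.univ.filter fun i => b ^ (j + 1) ∣ f i).card) ∣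
      ∏ i, f i := by
  have h : ∑ j ∈ Finset.range r, (Finset.univ.filter fun i => b ^ (j + 1) ∣ f i).card =
      ∑ i, ((Finset.range r).filter fun j => b ^ (j + 1) ∣ f i).card := by
    simp only [Finset.card_filter]
    exact Finset.sum_comm
  rw [h, ← Finset.prod_pow_eq_pow_sum]
  exact Finset.prod_dvd_prod_of_dvd _ _ fun i _ => pow_card_filter_pow_dvd b (f i) r

/-- If `q` meets every residue class modulo `m * n`, at least `n` of the integers `T - q i`
are divisible by `m`. -/
theorem le_card_filter_dvd_sub {ι : Type*} [Fintype ι] {m n : ℕ} (hm : 0 < m) (q : ι → ℤ)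
    (hq : Function.Surjective fun i => (q i : ZMod (m * n))) (T : ℤ) :
    n ≤ (Finset.univ.filter fun i => (m : ℤ) ∣ T - q i).card := by
  choose g hg using fun k : ℕ => hq ((T - m * k : ℤ) : ZMod (m * n))
  have hdvd (k : ℕ) : (m : ℤ) * n ∣ (T - m * k) - q (g k) := by
    have := (ZMod.intCast_eq_intCast_iff_dvd_sub _ _ _).1 (hg k)
    rwa [Nat.cast_mul] at this
  rw [← Finset.card_range n]
  refine Finset.card_le_card_of_injOn g (fun k _ => ?_) fun k hk l hl hkl => ?_
  · have h := ((dvd_mul_right (m : ℤ) n).trans (hdvd k)).add (dvd_mul_right (m : ℤ) k)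
    simpa [sub_right_comm] using h
  · have h := dvd_sub (hdvd k) (hdvd l)
    rw [hkl, show (T - (m : ℤ) * k) - q (g l) - ((T - m * l) - q (g l)) = m * ((l : ℤ) - k) by
      ring] at h
    have h' := Int.dvd_of_mul_dvd_mul_left (by exact_mod_cast hm.ne') h
    exact Nat.ModEq.eq_of_lt_of_lt (Nat.modEq_iff_dvd.2 h') (Finset.mem_range.1 hk)
      (Finset.mem_range.1 hl)

/-- **Integrality of the covering polynomial for a complete residue system.**
If `q 1, …, q (p ^ r)` are integers forming a complete residue system modulo
`p ^ r`, then for every integer `T` the product `Π_i (T − q i)` is divisible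
by `p ^ δ`, where `δ = Σ_{j=0}^{r−1} p ^ j`; hence
`h(T) = (1 / p ^ δ) · Π_i (T − q i)` is an integer-valued polynomial of
degree `p ^ r`. -/
theorem residue_system_polynomial_integer_valued
    (p r : ℕ) (hp : p.Prime)
    (q : Fin (p ^ r) → ℤ)
    (hq : Function.Injective fun i => ((q i : ZMod (p ^ r)))) :
    ∀ T : ℤ, (p : ℤ) ^ (∑ j ∈ Finset.range r, p ^ j) ∣ ∏ i, (T - q i) := by
  intro T
  have : NeZero (p ^ r) := ⟨(pow_pos hp.pos r).ne'⟩
  have hsurj : Function.Surjective fun i => (q i : ZMod (p ^ r)) :=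
    ((Fintype.bijective_iff_injective_and_card _).2 ⟨hq, by simp [ZMod.card]⟩).2
  refine (pow_dvd_pow _ ?_).trans (pow_sum_card_filter_dvd_prod_s11 (p : ℤ) (fun i => T - q i) r)
  rw [← Finset.sum_range_reflect]
  refine Finset.sum_le_sum fun j hj => ?_
  have hr : p ^ r = p ^ (j + 1) * p ^ (r - 1 - j) := by
    rw [← pow_add]
    congr 1
    have := Finset.mem_range.1 hj
    omega
  have h := le_card_filter_dvd_sub (pow_pos hp.pos (j + 1)) q (n := p ^ (r - 1 - j))
    (by rwa [← hr]) T
  simpa using h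
end

section
/- Let p be a prime, r ≥ 0, let q_1, q_2, …, q_{p^r} be integers forming a complete residue system modulo p^r, and set δ = Σ_{j=0}^{r−1} p^j and h(T) = (1/p^δ)·∏_{i=1}^{p^r} (T − q_i). Then for every integer T, p divides h(T) if and only if T ≡ q_i (mod p^{r+1}) for some i; equivalently, p^{δ+1} divides ∏_{i=1}^{p^r}(T − q_i) if and only if T is congruent modulo p^{r+1} to some q_i. -/
/-- The multiplicity of a prime `p` in `(p ^ r)!` is `1 + p + ⋯ + p ^ (r - 1)`. -/
theorem emultiplicity_factorial_prime_pow {p : ℕ} (hp : p.Prime) (r : ℕ) :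
    emultiplicity p (p ^ r).factorial = (∑ j ∈ Finset.range r, p ^ j : ℕ) := by
  induction r with
  | zero => simpa using hp.emultiplicity_one
  | succ r ih =>
    rw [pow_succ', hp.emultiplicity_factorial_mul, ih, Finset.sum_range_succ]
    push_cast
    rfl

/-- The multiplicity of `p` in an integer not divisible by `p ^ r` depends only on its residue
modulo `p ^ r`. -/
theorem emultiplicity_eq_emultiplicity_zmod_val {p r : ℕ} [NeZero (p ^ r)] {a : ℤ}
    (ha : ((a : ZMod (p ^ r))) ≠ 0) :
    emultiplicity (p : ℤ) a = emultiplicity p (a : ZMod (p ^ r)).val := by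
  rw [← Int.natCast_emultiplicity, ZMod.val_intCast]
  have hmod : ((p : ℤ) ^ r) ∣ a - a % ((p ^ r : ℕ) : ℤ) := by
    simpa using Int.dvd_self_sub_emod (x := a) (m := ((p ^ r : ℕ) : ℤ))
  have hna : ¬ (p : ℤ) ^ r ∣ a := by
    rw [ne_eq, ZMod.intCast_zmod_eq_zero_iff_dvd] at ha
    exact_mod_cast ha
  have hlt : emultiplicity (p : ℤ) a < emultiplicity (p : ℤ) (a % ((p ^ r : ℕ) : ℤ) - a) :=
    (emultiplicity_lt_iff_not_dvd.2 hna).trans_le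
      (le_emultiplicity_of_pow_dvd ((dvd_sub_comm).1 hmod))
  have := emultiplicity_add_of_gt hlt
  rw [sub_add_cancel] at this
  exact this.symm

/-- The product of the nonzero residues modulo `n`, as natural numbers, is `(n - 1)!`. -/
theorem ZMod.prod_val_erase_zero_mul (n : ℕ) [NeZero n] :
    n * ∏ x ∈ (Finset.univ : Finset (ZMod n)).erase 0, x.val = n.factorial := by
  obtain ⟨m, rfl⟩ := Nat.exists_eq_succ_of_ne_zero (NeZero.ne n)
  have : ∏ x ∈ (Finset.univ : Finset (ZMod (m + 1))).erase 0, x.val = m.factorial := by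
    rw [← Finset.prod_range_add_one_eq_factorial,
      ← Fin.prod_univ_eq_prod_range (fun i => i + 1) m]
    symm
    refine Finset.prod_bij (fun (i : Fin m) _ => (i.succ : Fin (m + 1))) ?_ ?_ ?_ ?_
    · intro i _
      exact Finset.mem_erase.2 ⟨Fin.succ_ne_zero i, Finset.mem_univ _⟩
    · intro i _ j _ h
      exact Fin.succ_injective _ h
    · intro x hx
      obtain ⟨i, hi⟩ := Fin.exists_succ_eq.2 (Finset.mem_erase.1 hx).1
      exact ⟨i, Finset.mem_univ _, hi⟩
    · intro i _
      exact (Fin.val_succ i).symm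
  exact (congrArg ((m + 1) * ·) this).trans (Nat.factorial_succ m).symm

/-- **Covering property of the residue-system polynomial.**
Let `q 1, …, q (p ^ r)` be integers forming a complete residue system modulo
`p ^ r`, `δ = Σ_{j=0}^{r−1} p ^ j` and `h(T) = (1 / p ^ δ) · Π_i (T − q i)`.
Then for every integer `T`, `p ∣ h(T)` — equivalently
`p ^ (δ+1) ∣ Π_i (T − q i)` — if and only if `T ≡ q i (mod p ^ (r+1))` for
some `i`. -/
theorem residue_system_polynomial_covering
    (p r : ℕ) (hp : p.Prime)
    (q : Fin (p ^ r) → ℤ)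
    (hq : Function.Injective fun i => ((q i : ZMod (p ^ r)))) :
    ∀ T : ℤ,
      ((p : ℤ) ^ ((∑ j ∈ Finset.range r, p ^ j) + 1) ∣ ∏ i, (T - q i)) ↔
        ∃ i, (p : ℤ) ^ (r + 1) ∣ (T - q i) := by
  intro T
  have : NeZero (p ^ r) := ⟨pow_ne_zero _ hp.ne_zero⟩
  have hpz : Prime (p : ℤ) := Nat.prime_iff_prime_int.1 hp
  have hinj : Function.Injective fun i => ((T - q i : ℤ) : ZMod (p ^ r)) := by
    intro i j h
    apply hq
    simpa using h
  have hbij : Function.Bijective fun i => ((T - q i : ℤ) : ZMod (p ^ r)) :=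
    (Fintype.bijective_iff_injective_and_card _).2 ⟨hinj, by simp [ZMod.card]⟩
  obtain ⟨i₀, hi₀⟩ := hbij.2 0
  have hne : ∀ i, i ≠ i₀ → ((T - q i : ℤ) : ZMod (p ^ r)) ≠ 0 := fun i hi h =>
    hi (hinj (h.trans hi₀.symm))
  have hrest : emultiplicity (p : ℤ) (∏ i ∈ Finset.univ.erase i₀, (T - q i)) =
      emultiplicity p (∏ x ∈ (Finset.univ : Finset (ZMod (p ^ r))).erase 0, x.val) := by
    rw [Finset.emultiplicity_prod hpz, Finset.emultiplicity_prod hp.prime]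
    refine Finset.sum_bij (fun i _ => ((T - q i : ℤ) : ZMod (p ^ r))) ?_ ?_ ?_ ?_
    · intro i hi
      exact Finset.mem_erase.2 ⟨hne i (Finset.mem_erase.1 hi).1, Finset.mem_univ _⟩
    · intro i _ j _ h
      exact hinj h
    · intro x hx
      obtain ⟨i, rfl⟩ := hbij.2 x
      refine ⟨i, Finset.mem_erase.2 ⟨?_, Finset.mem_univ _⟩, rfl⟩
      rintro rfl
      exact (Finset.mem_erase.1 hx).1 hi₀
    · intro i hi
      exact emultiplicity_eq_emultiplicity_zmod_val (hne i (Finset.mem_erase.1 hi).1)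
  have hsum : (r : ℕ∞) + emultiplicity (p : ℤ) (∏ i ∈ Finset.univ.erase i₀, (T - q i)) =
      (∑ j ∈ Finset.range r, p ^ j : ℕ) := by
    rw [hrest, ← emultiplicity_factorial_prime_pow hp, ← ZMod.prod_val_erase_zero_mul,
      emultiplicity_mul hp.prime, hp.emultiplicity_pow_self]
  have hex : (∃ i, (p : ℤ) ^ (r + 1) ∣ (T - q i)) ↔ (p : ℤ) ^ (r + 1) ∣ (T - q i₀) := by
    refine ⟨?_, fun h => ⟨i₀, h⟩⟩
    rintro ⟨i, hi⟩
    by_cases h : i = i₀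
    · exact h ▸ hi
    · refine absurd ((ZMod.intCast_zmod_eq_zero_iff_dvd _ _).2 ?_) (hne i h)
      exact_mod_cast (pow_dvd_pow (p : ℤ) r.le_succ).trans hi
  rw [hex, ← Finset.mul_prod_erase _ _ (Finset.mem_univ i₀), pow_dvd_iff_le_emultiplicity,
    pow_dvd_iff_le_emultiplicity, emultiplicity_mul hpz]
  generalize emultiplicity (p : ℤ) (∏ i ∈ Finset.univ.erase i₀, (T - q i)) = M at hsum ⊢
  have hM : M ≠ ⊤ := by
    rintro rfl
    rw [add_top] at hsum
    exact ENat.natCast_ne_top _ hsum.symm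
  rw [Nat.cast_add, ← hsum, Nat.cast_add, add_right_comm]
  exact ENat.add_le_add_iff_right hM
end

section
/- Let p be a prime, d ≥ 1, and let R ⊆ {0, 1, …, d−1}. Let Ω ⊆ ℤ/p^dℤ be the R-zero set modulo p^d. Then κ((ℤ/p^dℤ) \ Ω) = σ(R), where σ(R) = (p−1)·Σ_{r∈R} p^r. -/
/-- The digits of `c + p ^ n * a` with `c < p ^ n` and `a < p` in the positions `r ≤ n` are the
digits of `c` below `n`, followed by `a`. -/
theorem add_pow_mul_div_pow_mod {p n c a r : ℕ} (hp : 0 < p) (hc : c < p ^ n) (ha : a < p)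
    (hr : r ≤ n) :
    (c + p ^ n * a) / p ^ r % p = if r = n then a else c / p ^ r % p := by
  split_ifs with h
  · subst h
    rw [Nat.add_mul_div_left _ _ (by positivity), Nat.div_eq_of_lt hc, zero_add,
      Nat.mod_eq_of_lt ha]
  · obtain ⟨m, rfl⟩ : ∃ m, n = r + (m + 1) := ⟨n - r - 1, by omega⟩
    rw [show p ^ (r + (m + 1)) * a = p ^ r * (p * (p ^ m * a)) by ring,
      Nat.add_mul_div_left _ _ (by positivity), Nat.add_mul_mod_self_left]

/-- The fibre over `c < p ^ n` of reduction modulo `p ^ n` on `[0, p ^ (n + 1))` is parametrized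
by the leading digit. -/
theorem card_filter_mod_pow_eq {p n c : ℕ} (hp : 0 < p) (hc : c < p ^ n) (Q : ℕ → Prop)
    [DecidablePred Q] :
    (((Finset.range (p ^ (n + 1))).filter Q).filter fun b => b % p ^ n = c).card =
      ((Finset.range p).filter fun a => Q (c + p ^ n * a)).card := by
  have hpn : 0 < p ^ n := by positivity
  symm
  apply Finset.card_bij fun a _ => c + p ^ n * a
  · intro a ha
    simp only [Finset.mem_filter, Finset.mem_range] at ha ⊢
    refine ⟨⟨?_, ha.2⟩, by rw [Nat.add_mul_mod_self_left, Nat.mod_eq_of_lt hc]⟩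
    calc c + p ^ n * a < p ^ n * (a + 1) := by rw [mul_add]; omega
      _ ≤ p ^ n * p := Nat.mul_le_mul_left _ ha.1
      _ = p ^ (n + 1) := (pow_succ p n).symm
  · intro a _ b _ h
    exact Nat.eq_of_mul_eq_mul_left hpn (Nat.add_left_cancel h)
  · intro b hb
    simp only [Finset.mem_filter, Finset.mem_range] at hb
    obtain ⟨⟨hb, hQ⟩, rfl⟩ := hb
    have h := Nat.mod_add_div b (p ^ n)
    refine ⟨b / p ^ n, ?_, h⟩
    simp only [Finset.mem_filter, Finset.mem_range]
    exact ⟨Nat.div_lt_of_lt_mul (by rwa [← pow_succ]), by rwa [h]⟩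

/-- The size of the fibres of the complement of an `R`-zero set under reduction modulo `p ^ n`. -/
theorem card_fibre_compl_rzero_set {p n c : ℕ} (hp : 0 < p) (R : Finset ℕ)
    (hR : ∀ r ∈ R, r ≤ n) (hc : c < p ^ n) :
    (((Finset.range (p ^ (n + 1))).filter fun b => ¬ ∀ r ∈ R, b / p ^ r % p = 0).filter
        fun b => b % p ^ n = c).card =
      if ∀ r ∈ R.erase n, c / p ^ r % p = 0 then (if n ∈ R then p - 1 else 0) else p := by
  have key : ∀ a ∈ Finset.range p, ((¬ ∀ r ∈ R, (c + p ^ n * a) / p ^ r % p = 0) ↔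
      ((∀ r ∈ R.erase n, c / p ^ r % p = 0) → n ∈ R ∧ a ≠ 0)) := by
    intro a ha
    rw [Finset.mem_range] at ha
    have h : (∀ r ∈ R, (c + p ^ n * a) / p ^ r % p = 0) ↔
        ∀ r ∈ R, (if r = n then a else c / p ^ r % p) = 0 :=
      forall₂_congr fun r hr => by rw [add_pow_mul_div_pow_mod hp hc ha (hR r hr)]
    rw [h]
    simp only [Finset.mem_erase]
    grind
  rw [card_filter_mod_pow_eq hp hc]
  split_ifs with h hn
  · rw [Finset.filter_congr fun a ha => ((key a ha).trans (imp_iff_right h)).trans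
      (and_iff_right hn), Finset.filter_ne', Finset.card_erase_of_mem (Finset.mem_range.mpr hp),
      Finset.card_range]
  · rw [Finset.card_eq_zero, Finset.filter_eq_empty_iff]
    exact fun a ha hQ => hn ((key a ha).mp hQ h).1
  · rw [Finset.filter_true_of_mem fun a ha => (key a ha).mpr fun h' => absurd h' h,
      Finset.card_range]

/-- The number of elements of the complement of an `R`-zero set divisible by `p ^ n`. -/
theorem card_dvd_compl_rzero_set {p : ℕ} (n : ℕ) (hp : 0 < p) (R : Finset ℕ)
    (hR : ∀ r ∈ R, r ≤ n) :
    (((Finset.range (p ^ (n + 1))).filter fun b => ¬ ∀ r ∈ R, b / p ^ r % p = 0).filter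
        fun b => p ^ n ∣ b).card = if n ∈ R then p - 1 else 0 := by
  simp only [Nat.dvd_iff_mod_eq_zero]
  rw [card_fibre_compl_rzero_set hp R hR (by positivity)]
  simp

/-- The residues modulo `p ^ n` with more preimages in the complement of an `R`-zero set than that
complement has multiples of `p ^ n` form the complement of the `R \ {n}`-zero set. -/
theorem filter_card_fibre_compl_rzero_set {p n : ℕ} (hp : 0 < p) (R : Finset ℕ)
    (hR : ∀ r ∈ R, r ≤ n) :
    ((Finset.range (p ^ n)).filter fun c => (if n ∈ R then p - 1 else 0) <
      (((Finset.range (p ^ (n + 1))).filter fun b => ¬ ∀ r ∈ R, b / p ^ r % p = 0).filter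
        fun b => b % p ^ n = c).card) =
      (Finset.range (p ^ n)).filter fun c => ¬ ∀ r ∈ R.erase n, c / p ^ r % p = 0 := by
  refine Finset.filter_congr fun c hc => ?_
  rw [card_fibre_compl_rzero_set hp R hR (Finset.mem_range.mp hc)]
  by_cases h : ∀ r ∈ R.erase n, c / p ^ r % p = 0
  · rw [if_pos h]
    exact iff_of_false (lt_irrefl _) (not_not_intro h)
  · rw [if_neg h]
    exact iff_of_true (by split_ifs <;> omega) h

/-- **`κ` of the complement of an `R`-zero set.** For `R ⊆ {0,…,d−1}`, the
`R`-zero set `Ω ⊆ ℤ/p^dℤ` consists of the residues `c` whose base-`p` digit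
`c^{(r)} = c / p ^ r % p` vanishes for every `r ∈ R`. Then
`κ((ℤ/p^dℤ) \ Ω) = σ(R) = (p−1) · Σ_{r ∈ R} p ^ r`. -/
theorem kappa_compl_rzero_set (p d : ℕ) (hp : p.Prime) (hd : 1 ≤ d)
    (R : Finset ℕ) (hR : ∀ r ∈ R, r < d) :
    kappa p d
        ((Finset.range (p ^ d)).filter fun c => ¬ ∀ r ∈ R, c / p ^ r % p = 0)
      = (p - 1) * ∑ r ∈ R, p ^ r := by
  obtain ⟨d, rfl⟩ := Nat.exists_eq_add_of_le' hd
  clear hd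
  induction d generalizing R with
  | zero =>
    have hcard := card_dvd_compl_rzero_set 0 hp.pos R fun r hr => Nat.le_of_lt_succ (hR r hr)
    simp only [pow_zero, one_dvd, Finset.filter_true] at hcard
    rw [zero_add] at hcard ⊢
    rw [kappa, hcard]
    have hR0 : ∀ r ∈ R, r = 0 := fun r hr => Nat.lt_one_iff.mp (hR r hr)
    obtain rfl | rfl := Finset.subset_singleton_iff.mp
      fun r hr => Finset.mem_singleton.mpr (hR0 r hr)
    · simp
    · simp
  | succ d ih =>
    have hR' : ∀ r ∈ R, r ≤ d + 1 := fun r hr => Nat.le_of_lt_succ (hR r hr)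
    rw [kappa, card_dvd_compl_rzero_set (d + 1) hp.pos R hR']
    rw [filter_card_fibre_compl_rzero_set hp.pos R hR', ih (R.erase (d + 1)) fun r hr =>
      lt_of_le_of_ne (hR' r (Finset.mem_of_mem_erase hr)) (Finset.ne_of_mem_erase hr)]
    split_ifs with h
    · rw [← Finset.add_sum_erase R _ h, mul_add]
    · rw [Finset.erase_eq_of_notMem h, zero_mul, zero_add]
end

section
/- Let p be a prime, let d_1 ≥ d_2 ≥ … ≥ d_n ≥ 1 be integers, for each i let R_i ⊆ {0,…,d_i−1}, and let Ω_i ⊆ ℤ/p^{d_i}ℤ be the R_i-zero set modulo p^{d_i}. Then: (Upper bound) for every m > Σ_{i=1}^n σ(R_i) and all integers a_{ij} there exists a nonempty J ⊆ {1,…,m} such that the residue of Σ_{j∈J} a_{ij} modulo p^{d_i} lies in Ω_i for every i. (Tightness) for m = Σ_{i=1}^n σ(R_i) there exist integers a_{ij} (namely a_{ij} = −1 if Σ_{l<i} σ(R_l) < j ≤ Σ_{l≤i} σ(R_l) and a_{ij} = 0 otherwise) such that no nonempty J ⊆ {1,…,m} has the residue of Σ_{j∈J} a_{ij} modulo p^{d_i}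 in Ω_i for every i. -/
/-- The `R`-zero set modulo `N`: residues `c` such that in the base-`p`
representation of `c` (via its value in `[0, N)`), the digit
`c^{(r)} = c / p ^ r % p` is `0` for every `r ∈ R`. -/
def RZeroSet (p : ℕ) {N : ℕ} (R : Finset ℕ) : Set (ZMod N) :=
  {c | ∀ r ∈ R, ZMod.val c / p ^ r % p = 0}

open Finset in
/-- Functions on the subsets of `ι` which are represented by a multilinear polynomial of degree at
most `k` in the indicator variables. -/
def multilinearLE (F ι : Type*) [Field F] [DecidableEq ι] (k : ℕ) :
    Submodule F (Finset ι → F) :=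
  Submodule.span F {f | ∃ S : Finset ι, #S ≤ k ∧ f = fun J => if S ⊆ J then 1 else 0}

section multilinear

open Finset

variable {F ι : Type*} [Field F] [DecidableEq ι]

lemma indicator_mem_multilinearLE {k : ℕ} (S : Finset ι) (hS : #S ≤ k) :
    (fun J => if S ⊆ J then 1 else 0 : Finset ι → F) ∈ multilinearLE F ι k :=
  Submodule.subset_span ⟨S, hS, rfl⟩

lemma multilinearLE_mono {k l : ℕ} (h : k ≤ l) : multilinearLE F ι k ≤ multilinearLE F ι l :=
  Submodule.span_mono fun _ ⟨S, hS, hf⟩ => ⟨S, hS.trans h, hf⟩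

lemma one_mem_multilinearLE (k : ℕ) : (1 : Finset ι → F) ∈ multilinearLE F ι k := by
  convert indicator_mem_multilinearLE (F := F) (k := k) (∅ : Finset ι) (by simp) using 1
  ext J
  simp

lemma mul_mem_multilinearLE {k l : ℕ} {f g : Finset ι → F} (hf : f ∈ multilinearLE F ι k)
    (hg : g ∈ multilinearLE F ι l) : f * g ∈ multilinearLE F ι (k + l) := by
  have h := Submodule.mul_mem_mul hf hg
  rw [multilinearLE, multilinearLE, Submodule.span_mul_span] at h
  refine Submodule.span_mono ?_ h
  rintro _ ⟨_, ⟨S, hS, rfl⟩, _, ⟨T, hT, rfl⟩, rfl⟩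
  refine ⟨S ∪ T, (card_union_le S T).trans (by omega), ?_⟩
  ext J
  by_cases h1 : S ⊆ J <;> by_cases h2 : T ⊆ J <;> simp [union_subset_iff, h1, h2]

lemma pow_mem_multilinearLE {k : ℕ} {f : Finset ι → F} (hf : f ∈ multilinearLE F ι k) (e : ℕ) :
    f ^ e ∈ multilinearLE F ι (e * k) := by
  induction e with
  | zero => simpa using one_mem_multilinearLE _
  | succ e ih =>
    rw [pow_succ, Nat.succ_mul]
    exact mul_mem_multilinearLE ih hf

lemma prod_mem_multilinearLE {κ : Type*} (s : Finset κ) (k : κ → ℕ) (f : κ → Finset ι → F)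
    (hf : ∀ x ∈ s, f x ∈ multilinearLE F ι (k x)) :
    ∏ x ∈ s, f x ∈ multilinearLE F ι (∑ x ∈ s, k x) := by
  classical
  induction s using Finset.induction_on with
  | empty => simpa using one_mem_multilinearLE _
  | insert x s hx ih =>
    rw [prod_insert hx, sum_insert hx]
    exact mul_mem_multilinearLE (hf x (by simp)) (ih fun y hy => hf y (by simp [hy]))

lemma choose_sum_inter_mem_multilinearLE (b : ι → ℕ) (s : Finset ι) (k : ℕ) :
    (fun J => (((∑ j ∈ s ∩ J, b j).choose k : ℕ) : F)) ∈ multilinearLE F ι k := by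
  induction s using Finset.induction_on generalizing k with
  | empty =>
    cases k with
    | zero => simpa [Pi.one_def] using one_mem_multilinearLE (F := F) (ι := ι) 0
    | succ k =>
      convert (multilinearLE F ι (k + 1)).zero_mem using 1
      ext J
      simp
  | insert x s hx ih =>
    have key : (fun J => (((∑ j ∈ insert x s ∩ J, b j).choose k : ℕ) : F)) =
        ∑ uv ∈ antidiagonal k,
          (fun J => (((if x ∈ J then b x else 0).choose uv.1 : ℕ) : F)) *
            fun J => (((∑ j ∈ s ∩ J, b j).choose uv.2 : ℕ) : F) := by
      ext J
      have : ∑ j ∈ insert x s ∩ J, b j = (if x ∈ J then b x else 0) + ∑ j ∈ s ∩ J, b j := by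
        by_cases hJ : x ∈ J
        · rw [insert_inter_of_mem hJ, sum_insert (by simp [hx]), if_pos hJ]
        · rw [insert_inter_of_notMem hJ, if_neg hJ, zero_add]
      rw [this, Nat.add_choose_eq]
      simp [Finset.sum_apply]
    rw [key]
    refine Submodule.sum_mem _ fun uv huv => ?_
    rw [← mem_antidiagonal.1 huv]
    refine mul_mem_multilinearLE ?_ (ih uv.2)
    rcases uv.1 with _ | u
    · simpa [Pi.one_def] using one_mem_multilinearLE (F := F) (ι := ι) 0
    · convert Submodule.smul_mem _ ((b x).choose (u + 1) : F)
        (indicator_mem_multilinearLE (F := F) (k := u + 1) {x} (by simp)) using 1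
      ext J
      by_cases hJ : x ∈ J <;> simp [hJ]

lemma choose_sum_mem_multilinearLE [Fintype ι] (b : ι → ℕ) (k : ℕ) :
    (fun J => (((∑ j ∈ J, b j).choose k : ℕ) : F)) ∈ multilinearLE F ι k := by
  simpa using choose_sum_inter_mem_multilinearLE (F := F) b univ k

lemma sum_neg_one_pow_card_mul_eq_zero [Fintype ι] {k : ℕ} (hk : k < Fintype.card ι)
    {f : Finset ι → F} (hf : f ∈ multilinearLE F ι k) : ∑ J, (-1) ^ #J * f J = 0 := by
  induction hf using Submodule.span_induction with
  | mem f hf =>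
    obtain ⟨S, hS, rfl⟩ := hf
    obtain ⟨x, hx⟩ : ∃ x, x ∉ S := by
      by_contra! h
      rw [eq_univ_of_forall h, card_univ] at hS
      omega
    have h := sum_powerset_insert (notMem_erase x univ)
      fun J : Finset ι => (-1 : F) ^ #J * if S ⊆ J then 1 else 0
    rw [insert_erase (mem_univ x), powerset_univ] at h
    rw [h, ← sum_add_distrib]
    refine sum_eq_zero fun J hJ => ?_
    have hxJ : x ∉ J := fun h => notMem_erase x univ (mem_powerset.1 hJ h)
    simp only [card_insert_of_notMem hxJ, subset_insert_iff_of_notMem hx]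
    ring
  | zero => simp
  | add f g _ _ hf hg => simp [mul_add, sum_add_distrib, hf, hg]
  | smul c f _ hf =>
    simp only [Pi.smul_apply, smul_eq_mul, mul_left_comm _ c, ← mul_sum, hf, mul_zero]

/-- A multilinear polynomial of degree less than the number of variables which does not vanish at
the origin does not vanish at some other vertex of the cube. -/
lemma exists_nonempty_ne_zero_of_mem_multilinearLE [Fintype ι] {k : ℕ} (hk : k < Fintype.card ι)
    {f : Finset ι → F} (hf : f ∈ multilinearLE F ι k) (h0 : f ∅ ≠ 0) :
    ∃ J : Finset ι, J.Nonempty ∧ f J ≠ 0 := by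
  by_contra! h
  have hsum := sum_neg_one_pow_card_mul_eq_zero hk hf
  rw [sum_eq_single ∅ (fun J _ hJ => by rw [h J (nonempty_iff_ne_empty.2 hJ), mul_zero])
    (by simp)] at hsum
  simp [h0] at hsum

end multilinear

lemma choose_prime_pow_modEq (p : ℕ) [Fact p.Prime] (N r : ℕ) :
    N.choose (p ^ r) ≡ N / p ^ r [MOD p] := by
  have hp : p.Prime := Fact.out
  induction r generalizing N with
  | zero => simp [Nat.ModEq.refl]
  | succ r ih =>
    have h := Choose.choose_modEq_choose_mod_mul_choose_div_nat (n := N) (k := p ^ (r + 1)) (p := p)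
    have h1 : p ^ (r + 1) % p = 0 := Nat.mod_eq_zero_of_dvd (dvd_pow_self p (by omega))
    have h2 : p ^ (r + 1) / p = p ^ r := by rw [pow_succ, Nat.mul_div_cancel _ hp.pos]
    rw [h1, h2, Nat.choose_zero_right, one_mul] at h
    refine h.trans ((ih (N / p)).trans ?_)
    rw [Nat.div_div_eq_div_mul, ← pow_succ']

lemma natCast_mem_RZeroSet_iff {p d : ℕ} {R : Finset ℕ} (hR : ∀ r ∈ R, r < d) (N : ℕ) :
    (N : ZMod (p ^ d)) ∈ RZeroSet p R ↔ ∀ r ∈ R, N / p ^ r % p = 0 := by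
  refine forall₂_congr fun r hr => ?_
  have hd : p ^ d = p ^ r * p ^ (d - r) := by rw [← pow_add, Nat.add_sub_cancel' (hR r hr).le]
  rw [ZMod.val_natCast, hd, Nat.mod_mul_right_div_self,
    Nat.mod_mod_of_dvd _ (dvd_pow_self p (by have := hR r hr; omega))]

lemma sum_digit_mul_pow (p c d : ℕ) : ∑ r ∈ Finset.range d, c / p ^ r % p * p ^ r = c % p ^ d := by
  induction d with
  | zero => simp [Nat.mod_one]
  | succ d ih => rw [Finset.sum_range_succ, ih, Nat.mod_pow_succ, mul_comm]

lemma add_lt_pow_of_digit_eq_zero {p : ℕ} (hp : 0 < p) {c d : ℕ} (hc : c < p ^ d) {R : Finset ℕ}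
    (hR : ∀ r ∈ R, r < d) (h : ∀ r ∈ R, c / p ^ r % p = 0) :
    c + (p - 1) * ∑ r ∈ R, p ^ r < p ^ d := by
  have hsub : R ⊆ Finset.range d := fun r hr => Finset.mem_range.2 (hR r hr)
  have h1 : (p - 1) * ∑ r ∈ R, p ^ r =
      ∑ r ∈ Finset.range d, if r ∈ R then (p - 1) * p ^ r else 0 := by
    rw [Finset.mul_sum, ← Finset.sum_filter, Finset.filter_mem_eq_inter,
      Finset.inter_eq_right.2 hsub]
  have h2 : (p - 1) * ∑ r ∈ Finset.range d, p ^ r + 1 = p ^ d := by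
    obtain ⟨q, rfl⟩ := Nat.exists_eq_succ_of_ne_zero hp.ne'
    clear * -
    induction d with
    | zero => simp
    | succ d ih =>
      rw [Finset.sum_range_succ, pow_succ]
      simp only [Nat.succ_eq_add_one, Nat.add_sub_cancel] at ih ⊢
      nlinarith
  rw [← h2, Nat.lt_succ_iff, h1]
  nth_rewrite 1 [← Nat.mod_eq_of_lt hc]
  rw [← sum_digit_mul_pow, ← Finset.sum_add_distrib, Finset.mul_sum]
  refine Finset.sum_le_sum fun r _ => ?_
  by_cases hr : r ∈ R
  · simp [hr, h r hr]
  · have : c / p ^ r % p ≤ p - 1 := Nat.le_sub_one_of_lt (Nat.mod_lt _ hp)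
    simpa [hr] using Nat.mul_le_mul_right (p ^ r) this

lemma neg_natCast_notMem_RZeroSet {p d k : ℕ} (hp : 0 < p) {R : Finset ℕ}
    (hR : ∀ r ∈ R, r < d) (hk0 : 0 < k) (hk : k ≤ (p - 1) * ∑ r ∈ R, p ^ r) :
    (-(k : ZMod (p ^ d))) ∉ RZeroSet p R := by
  intro h
  have : NeZero (p ^ d) := ⟨(pow_pos hp d).ne'⟩
  have hlt := add_lt_pow_of_digit_eq_zero hp (ZMod.val_lt (-(k : ZMod (p ^ d)))) hR h
  have hz : (((-(k : ZMod (p ^ d))).val + k : ℕ) : ZMod (p ^ d)) = 0 := by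
    rw [Nat.cast_add, ZMod.natCast_zmod_val, neg_add_cancel]
  have := Nat.le_of_dvd (by omega) ((ZMod.natCast_eq_zero_iff _ _).1 hz)
  omega

lemma exists_nonempty_sum_mem_RZeroSet {ι κ : Type*} [Fintype ι] [Fintype κ] [DecidableEq ι]
    (p : ℕ) [Fact p.Prime] (d : κ → ℕ) (R : κ → Finset ℕ) (hR : ∀ i, ∀ r ∈ R i, r < d i)
    (hcard : ∑ i, (p - 1) * ∑ r ∈ R i, p ^ r < Fintype.card ι) (a : κ → ι → ℤ) :
    ∃ J : Finset ι, J.Nonempty ∧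
      ∀ i, ((∑ j ∈ J, a i j : ℤ) : ZMod (p ^ d i)) ∈ RZeroSet p (R i) := by
  have hp : p.Prime := Fact.out
  have hne (i : κ) : NeZero (p ^ d i) := ⟨(pow_pos hp.pos _).ne'⟩
  let b : κ → ι → ℕ := fun i j => (a i j : ZMod (p ^ d i)).val
  have hb (i : κ) (J : Finset ι) :
      ((∑ j ∈ J, a i j : ℤ) : ZMod (p ^ d i)) = ((∑ j ∈ J, b i j : ℕ) : ZMod (p ^ d i)) := by
    simp [b]
  let f : Finset ι → ZMod p := ∏ i, ∏ r ∈ R i,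
    (1 - (fun J => (((∑ j ∈ J, b i j).choose (p ^ r) : ℕ) : ZMod p)) ^ (p - 1))
  have hf : f ∈ multilinearLE (ZMod p) ι (∑ i, (p - 1) * ∑ r ∈ R i, p ^ r) := by
    simp only [Finset.mul_sum]
    exact prod_mem_multilinearLE _ _ _ fun i _ => prod_mem_multilinearLE _ _ _ fun r _ =>
      Submodule.sub_mem _ (one_mem_multilinearLE _)
        (pow_mem_multilinearLE (choose_sum_mem_multilinearLE (b i) _) _)
  have h0 : f ∅ ≠ 0 := by
    have (r : ℕ) : Nat.choose 0 (p ^ r) = 0 := Nat.choose_eq_zero_of_lt (pow_pos hp.pos r)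
    simp [f, this, Finset.prod_apply, zero_pow (Nat.sub_ne_zero_of_lt hp.one_lt)]
  obtain ⟨J, hJ, hfJ⟩ := exists_nonempty_ne_zero_of_mem_multilinearLE hcard hf h0
  refine ⟨J, hJ, fun i => ?_⟩
  rw [hb, natCast_mem_RZeroSet_iff (hR i)]
  intro r hr
  simp only [f, Finset.prod_apply, Finset.prod_ne_zero_iff] at hfJ
  have h := hfJ i (Finset.mem_univ i) r hr
  rw [← Nat.dvd_iff_mod_eq_zero, ← ZMod.natCast_eq_zero_iff,
    ← (ZMod.natCast_eq_natCast_iff _ _ _).2 (choose_prime_pow_modEq p _ r)]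
  by_contra hc
  exact h (by simp [ZMod.pow_card_sub_one_eq_one hc])

/-- **Exact threshold for `R`-zero sets.** For `d 1 ≥ … ≥ d n ≥ 1`,
`R i ⊆ {0,…,d i − 1}` and `Ω i` the `R i`-zero set modulo `p ^ d i`:
(upper bound) if `m > Σᵢ σ(R i)` with `σ(R) = (p−1) Σ_{r ∈ R} p ^ r`, every
integer array admits a nonempty `J` with `Σ_{j ∈ J} a i j mod p ^ d i ∈ Ω i`
for all `i`; (tightness) for `m = Σᵢ σ(R i)` some integer array admits no
such `J`. -/
theorem rzero_olson (p n : ℕ) (hp : p.Prime)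
    (d : Fin n → ℕ) (hd1 : ∀ i, 1 ≤ d i)
    (hmono : ∀ i j : Fin n, i ≤ j → d j ≤ d i)
    (R : Fin n → Finset ℕ) (hR : ∀ i, ∀ r ∈ R i, r < d i) :
    (∀ m : ℕ, (∑ i, (p - 1) * ∑ r ∈ R i, p ^ r) < m →
      ∀ a : Fin n → Fin m → ℤ,
        ∃ J : Finset (Fin m), J.Nonempty ∧
          ∀ i, ((∑ j ∈ J, a i j : ℤ) : ZMod (p ^ d i)) ∈ RZeroSet p (R i)) ∧
    (∃ a : Fin n → Fin (∑ i, (p - 1) * ∑ r ∈ R i, p ^ r) → ℤ,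
      ∀ J : Finset (Fin (∑ i, (p - 1) * ∑ r ∈ R i, p ^ r)), J.Nonempty →
        ¬ ∀ i, ((∑ j ∈ J, a i j : ℤ) : ZMod (p ^ d i)) ∈ RZeroSet p (R i)) := by
  have : Fact p.Prime := ⟨hp⟩
  refine ⟨fun m hm a => exists_nonempty_sum_mem_RZeroSet p d R hR (by simpa using hm) a,
    fun i j => if (finSigmaFinEquiv.symm j).1 = i then -1 else 0, fun J ⟨j, hj⟩ hJ => ?_⟩
  set i := (finSigmaFinEquiv.symm j).1 with hi
  let T := {x ∈ J | (finSigmaFinEquiv.symm x).1 = i}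
  have hT : T.card ≤ (p - 1) * ∑ r ∈ R i, p ^ r := by
    have hsub : T.map finSigmaFinEquiv.symm.toEmbedding ⊆
        ({i} : Finset (Fin n)).sigma fun _ => Finset.univ := by
      intro x hx
      obtain ⟨y, hy, rfl⟩ := Finset.mem_map.1 hx
      simpa using (Finset.mem_filter.1 hy).2
    simpa using Finset.card_le_card hsub
  have hsum : (∑ x ∈ J, if (finSigmaFinEquiv.symm x).1 = i then -1 else 0 : ℤ) = -T.card := by
    simp [← Finset.sum_filter, T]
  have h := hJ i
  rw [hsum, Int.cast_neg, Int.cast_natCast] at h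
  exact neg_natCast_notMem_RZeroSet hp.pos (hR i)
    (Finset.card_pos.2 ⟨j, Finset.mem_filter.2 ⟨hj, hi.symm⟩⟩) hT h
end

section
/- Let p be a prime, let d_1 ≥ d_2 ≥ … ≥ d_n ≥ 1 be integers, and let a_{ij} (i = 1,…,n, j = 1,…,m) be integers such that Σ_{i=1}^n a_{ij} is divisible by p for every j. If m > p^{d_n −1} − 1 + Σ_{i=1}^{n−1} (p^{d_i} − 1), then there exists a nonempty subset J ⊆ {1,…,m} such that Σ_{j∈J} a_{ij} is divisible by p^{d_i} for every i = 1,…,n. -/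
/-- A product of more than `∑ i, (k i - 1)` elements of the ideal generated by the `x i` vanishes
when `x i ^ k i = 0` for every `i`. -/
theorem prod_eq_zero_of_mem_span_of_pow_eq_zero {R ι κ : Type*} [CommRing R] [Fintype ι]
    [Fintype κ] (x : ι → R) (k : ι → ℕ) (hx : ∀ i, x i ^ k i = 0) (y : κ → R)
    (hy : ∀ j, y j ∈ Ideal.span (Set.range x)) (hcard : ∑ i, (k i - 1) < Fintype.card κ) :
    ∏ j, y j = 0 := by
  classical
  simp only [Ideal.mem_span_range_iff_exists_fun] at hy
  choose c hc using hy
  simp only [← hc, Finset.prod_univ_sum]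
  refine Finset.sum_eq_zero fun φ _ => ?_
  rw [Finset.prod_mul_distrib]
  suffices h : ∏ j, x (φ j) = 0 by rw [h, mul_zero]
  obtain ⟨i, hi⟩ : ∃ i, k i ≤ (Finset.univ.filter fun j => φ j = i).card := by
    by_contra! h
    have h1 : Fintype.card κ = ∑ i, (Finset.univ.filter fun j => φ j = i).card :=
      Finset.card_eq_sum_card_fiberwise fun _ _ => Finset.mem_coe.2 (Finset.mem_univ _)
    have h2 : ∑ i, (Finset.univ.filter fun j => φ j = i).card ≤ ∑ i, (k i - 1) :=
      Finset.sum_le_sum fun i _ => Nat.le_sub_one_of_lt (h i)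
    omega
  rw [← Finset.prod_filter_mul_prod_filter_not Finset.univ (fun j => φ j = i),
    Finset.prod_congr rfl (g := fun _ => x i) (by simp +contextual), Finset.prod_const,
    pow_eq_zero_of_le hi (hx i), zero_mul]

/-- **Olson's theorem**: a family of more than `∑ i, (p ^ e i - 1)` elements of the finite abelian
`p`-group `∏ i, ℤ / p ^ e i` has a nonempty zero-sum subfamily. -/
theorem exists_nonempty_sum_eq_zero_of_card_gt {ι κ : Type*} [Fintype ι] [Fintype κ] (p : ℕ)
    [Fact p.Prime] (e : ι → ℕ) (g : κ → ∀ i, ZMod (p ^ e i))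
    (hcard : ∑ i, (p ^ e i - 1) < Fintype.card κ) :
    ∃ J : Finset κ, J.Nonempty ∧ ∑ j ∈ J, g j = 0 := by
  classical
  let G := ∀ i, ZMod (p ^ e i)
  let X : Multiplicative G →* AddMonoidAlgebra (ZMod p) G := AddMonoidAlgebra.of (ZMod p) G
  let u : ι → Multiplicative G := fun i => .ofAdd (Pi.single i 1)
  have hu (i : ι) : (1 - X (u i)) ^ p ^ e i = 0 := by
    have : CharP (AddMonoidAlgebra (ZMod p) G) p :=
      charP_of_injective_algebraMap' (ZMod p) p
    have h : u i ^ p ^ e i = 1 := by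
      rw [← ofAdd_nsmul, ← Pi.single_smul, nsmul_one, ZMod.natCast_self, Pi.single_zero, ofAdd_zero]
    rw [sub_pow_char_pow, one_pow, ← map_pow, h, map_one, sub_self]
  have hspan (h : Multiplicative G) :
      1 - X h ∈ Ideal.span (Set.range fun i => 1 - X (u i)) := by
    have hprod : h = ∏ i, u i ^ (h.toAdd i).val := by
      apply Multiplicative.toAdd.injective
      rw [toAdd_prod]
      conv_lhs => rw [← Finset.univ_sum_single h.toAdd]
      refine Finset.sum_congr rfl fun i _ => ?_
      rw [toAdd_pow, toAdd_ofAdd, ← Pi.single_smul, nsmul_one, ZMod.natCast_zmod_val]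
    rw [← Ideal.Quotient.eq_zero_iff_mem, map_sub, map_one, sub_eq_zero, hprod, map_prod, map_prod]
    refine (Finset.prod_eq_one fun i _ => ?_).symm
    have hi := Ideal.Quotient.eq_zero_iff_mem.2
      (Ideal.subset_span (Set.mem_range_self (f := fun i => 1 - X (u i)) i))
    rw [map_sub, map_one, sub_eq_zero] at hi
    rw [map_pow, map_pow, ← hi, one_pow]
  have hzero := prod_eq_zero_of_mem_span_of_pow_eq_zero _ _ hu
    (fun j => 1 - X (.ofAdd (g j))) (fun j => hspan _) hcard
  by_contra! hne
  have hcoeff (J : Finset κ) : ((-1) ^ J.card * ∏ j ∈ J, X (.ofAdd (g j)) :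
      AddMonoidAlgebra (ZMod p) G).coeff 0 = if J = ∅ then 1 else 0 := by
    rw [← map_prod, ← ofAdd_sum, AddMonoidAlgebra.of_apply, toAdd_ofAdd]
    split_ifs with hJ
    · simp [hJ, AddMonoidAlgebra.coeff_single]
    · have h := hne J (Finset.nonempty_iff_ne_empty.2 hJ)
      rcases neg_one_pow_eq_or (AddMonoidAlgebra (ZMod p) G) J.card with hs | hs <;>
        simp [hs, AddMonoidAlgebra.coeff_single, h]
  have h0 := congrArg (fun f => f.coeff 0) hzero
  simp [Finset.prod_sub, AddMonoidAlgebra.coeff_sum, Finsupp.finsetSum_apply, hcoeff] at h0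

/-- **Corollary of Olson's theorem for arrays with column sums divisible by `p`.**
Let `d 0 ≥ d 1 ≥ … ≥ d n ≥ 1` (indices `0,…,n`, the last one denoted
`Fin.last n`) and let `a` be an integer array whose column sums are divisible
by `p`. If `m > p ^ (d_last − 1) − 1 + Σ_{i < n} (p ^ d i − 1)`, then there is
a nonempty `J ⊆ {1,…,m}` with `p ^ d i ∣ Σ_{j ∈ J} a i j` for every `i`. -/
theorem olson_corollary_even_columns (p n m : ℕ) (hp : p.Prime)
    (d : Fin (n + 1) → ℕ) (hd1 : ∀ i, 1 ≤ d i)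
    (hmono : ∀ i j : Fin (n + 1), i ≤ j → d j ≤ d i)
    (a : Fin (n + 1) → Fin m → ℤ)
    (hcol : ∀ j : Fin m, (p : ℤ) ∣ ∑ i, a i j)
    (hm : p ^ (d (Fin.last n) - 1) - 1 + ∑ i : Fin n, (p ^ d i.castSucc - 1) < m) :
    ∃ J : Finset (Fin m), J.Nonempty ∧
      ∀ i, (p : ℤ) ^ d i ∣ ∑ j ∈ J, a i j := by
  have : Fact p.Prime := ⟨hp⟩
  choose s hs using hcol
  let e : Fin (n + 1) → ℕ := Fin.snoc (fun i : Fin n => d i.castSucc) (d (Fin.last n) - 1)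
  let b : Fin (n + 1) → Fin m → ℤ := Fin.snoc (fun i : Fin n => a i.castSucc) s
  obtain ⟨J, hJ, hsum⟩ := exists_nonempty_sum_eq_zero_of_card_gt p e
    (fun j i => (b i j : ZMod (p ^ e i)))
    (by simpa [e, Fin.sum_univ_castSucc, add_comm] using hm)
  have hdvd (i : Fin (n + 1)) : (p : ℤ) ^ e i ∣ ∑ j ∈ J, b i j := by
    have h := congrFun hsum i
    rw [Finset.sum_apply, ← Int.cast_sum] at h
    exact_mod_cast (ZMod.intCast_zmod_eq_zero_iff_dvd _ _).1 h
  have hinit (i : Fin n) : (p : ℤ) ^ d i.castSucc ∣ ∑ j ∈ J, a i.castSucc j := by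
    simpa [e, b] using hdvd i.castSucc
  refine ⟨J, hJ, Fin.lastCases ?_ hinit⟩
  have htotal : (p : ℤ) ^ d (Fin.last n) ∣
      ∑ i : Fin n, ∑ j ∈ J, a i.castSucc j + ∑ j ∈ J, a (Fin.last n) j := by
    have h : (p : ℤ) ^ (d (Fin.last n) - 1) ∣ ∑ j ∈ J, s j := by
      simpa [e, b] using hdvd (Fin.last n)
    rw [← Fin.sum_univ_castSucc (fun i => ∑ j ∈ J, a i j), Finset.sum_comm,
      Finset.sum_congr rfl fun j _ => hs j, ← Finset.mul_sum,
      ← mul_pow_sub_one (Nat.one_le_iff_ne_zero.1 (hd1 _))]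
    exact mul_dvd_mul_left _ h
  exact (dvd_add_right (Finset.dvd_sum fun i _ =>
    (pow_dvd_pow _ (hmono _ _ (Fin.le_last _))).trans (hinit i))).1 htotal
end

section
/- Let p be an odd prime and d ≥ 1. Every graph G on n vertices with more than (p^d − 1)·n edges contains a nonempty p^d-divisible subgraph, i.e., a nonempty subset E' of its edges such that for every vertex v, the number of edges of E' incident to v is divisible by p^d. -/
/-- A finite sum of elements of a commutative semiring whose `(k + 1)`-st powers vanish is nilpotent,
with an explicit exponent. -/
theorem Finset.sum_pow_eq_zero_of_pow_succ_eq_zero {R ι : Type*} [CommSemiring R] (s : Finset ι)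
    (x : ι → R) (k : ℕ) (h : ∀ i ∈ s, x i ^ (k + 1) = 0) :
    (∑ i ∈ s, x i) ^ (s.card * k + 1) = 0 := by
  classical
  induction s using Finset.induction_on with
  | empty => simp
  | insert a s ha ih =>
    rw [Finset.sum_insert ha, Finset.card_insert_of_notMem ha]
    refine (Commute.all _ _).add_pow_eq_zero_of_add_le_succ_of_pow_eq_zero
      (h a (Finset.mem_insert_self a s)) (ih fun i hi => h i (Finset.mem_insert_of_mem hi)) ?_
    linarith

theorem Ideal.one_sub_prod_pow_mem {R ι : Type*} [CommRing R] (I : Ideal R) (s : Finset ι)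
    (x : ι → R) (n : ι → ℕ) (h : ∀ i ∈ s, 1 - x i ∈ I) : 1 - ∏ i ∈ s, x i ^ n i ∈ I := by
  rw [← Ideal.Quotient.mk_eq_mk_iff_sub_mem, map_one, map_prod, eq_comm]
  refine Finset.prod_eq_one fun i hi => ?_
  have hi' := h i hi
  rw [← Ideal.Quotient.mk_eq_mk_iff_sub_mem, map_one] at hi'
  rw [map_pow, ← hi', one_pow]

theorem Ideal.le_sum_of_mem {R ι : Type*} [CommSemiring R] (s : Finset ι) (J : ι → Ideal R)
    {i : ι} (hi : i ∈ s) : J i ≤ ∑ i ∈ s, J i := by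
  rw [Ideal.sum_eq_sup]
  exact Finset.le_sup hi

/-- An element of the group algebra of `(ℤ/q)^V` is a monomial in the standard generators. -/
theorem AddMonoidAlgebra.single_eq_prod_single_pow {K V : Type*} [CommSemiring K] [Fintype V]
    [DecidableEq V] (q : ℕ) [NeZero q] (g : V → ZMod q) :
    (AddMonoidAlgebra.single g 1 : AddMonoidAlgebra K (V → ZMod q)) =
      ∏ v, AddMonoidAlgebra.single (Pi.single v 1) 1 ^ (g v).val := by
  simp only [AddMonoidAlgebra.single_pow, one_pow, AddMonoidAlgebra.prod_single,
    Finset.prod_const_one]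
  congr 1
  conv_lhs => rw [← Finset.univ_sum_single g]
  refine Finset.sum_congr rfl fun v _ => ?_
  rw [← Pi.single_smul]
  simp

/-- **Olson's theorem** for `(ℤ/p^d)^V`: every family of more than `(p ^ d - 1) * |V|` elements has
a nonempty subfamily with sum zero. -/
theorem ZMod.exists_nonempty_sum_eq_zero_of_card_lt {ι V : Type*} [Fintype V]
    (p d : ℕ) (hp : p.Prime) (s : Finset ι) (g : ι → V → ZMod (p ^ d))
    (hs : (p ^ d - 1) * Fintype.card V < s.card) :
    ∃ t ⊆ s, t.Nonempty ∧ ∑ i ∈ t, g i = 0 := by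
  classical
  have : Fact p.Prime := ⟨hp⟩
  have hq : p ^ d - 1 + 1 = p ^ d := Nat.sub_add_cancel (Nat.pow_pos hp.pos)
  let A := AddMonoidAlgebra (ZMod p) (V → ZMod (p ^ d))
  have hzero : ∏ i ∈ s, (1 - AddMonoidAlgebra.single (g i) 1 : A) = 0 := by
    have : CharP A p := charP_of_injective_algebraMap (algebraMap (ZMod p) A).injective p
    let J : V → Ideal A := fun v => Ideal.span {1 - AddMonoidAlgebra.single (Pi.single v 1) 1}
    have hJ : (∑ v, J v) ^ (Fintype.card V * (p ^ d - 1) + 1) = 0 := by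
      refine Finset.sum_pow_eq_zero_of_pow_succ_eq_zero Finset.univ J _ fun v _ => ?_
      rw [hq, Ideal.span_singleton_pow, sub_pow_char_pow, AddMonoidAlgebra.single_pow,
        ← Pi.single_smul]
      have hchar : p ^ d • (1 : ZMod (p ^ d)) = 0 := by
        rw [nsmul_one, ZMod.natCast_self]
      rw [hchar, Pi.single_zero, one_pow, one_pow, ← AddMonoidAlgebra.one_def, sub_self]
      simp
    have hmem := Ideal.prod_mem_prod (s := s) (I := fun _ => ∑ v, J v)
      (x := fun i => 1 - AddMonoidAlgebra.single (g i) 1) fun i _ => by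
        rw [AddMonoidAlgebra.single_eq_prod_single_pow]
        exact Ideal.one_sub_prod_pow_mem _ _ _ _ fun v hv =>
          Ideal.le_sum_of_mem _ J hv (Ideal.mem_span_singleton_self _)
    rw [Finset.prod_const, pow_eq_zero_of_le (by rw [mul_comm]; exact hs) hJ] at hmem
    exact hmem
  by_contra! hne
  have hcoeff : (∏ i ∈ s, (1 - AddMonoidAlgebra.single (g i) 1 : A)).coeff 0 = 1 := by
    simp only [sub_eq_add_neg, Finset.prod_one_add]
    rw [AddMonoidAlgebra.coeff_sum, Finsupp.finsetSum_apply, Finset.sum_eq_single ∅]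
    · simp
    · intro t ht hte
      rw [Finset.prod_congr rfl fun i _ => (AddMonoidAlgebra.single_neg (g i) (1 : ZMod p)).symm,
        AddMonoidAlgebra.prod_single, AddMonoidAlgebra.coeff_single]
      exact Finsupp.single_eq_of_ne
        (hne t (Finset.mem_powerset.1 ht) (Finset.nonempty_iff_ne_empty.2 hte)).symm
    · simp
  rw [hzero] at hcoeff
  simp at hcoeff


/-- **`p^d`-divisible subgraphs, odd prime case.** For an odd prime `p`, every
graph on `n` vertices with more than `(p ^ d − 1) · n` edges contains a
nonempty `p ^ d`-divisible subgraph: a nonempty set `E'` of edges such that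
every vertex is incident to a number of edges of `E'` divisible by `p ^ d`. -/
theorem odd_prime_power_divisible_subgraph
    (p d : ℕ) (hp : p.Prime) (hodd : p ≠ 2) (hd : 1 ≤ d)
    {V : Type*} [Fintype V] [DecidableEq V]
    (G : SimpleGraph V) [DecidableRel G.Adj]
    (hm : (p ^ d - 1) * Fintype.card V < G.edgeFinset.card) :
    ∃ E' ⊆ G.edgeFinset, E'.Nonempty ∧
      ∀ v : V, p ^ d ∣ (E'.filter fun e => v ∈ e).card := by
  obtain ⟨t, hts, htne, ht⟩ := ZMod.exists_nonempty_sum_eq_zero_of_card_lt p d hp G.edgeFinset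
    (fun e v => if v ∈ e then 1 else 0) hm
  refine ⟨t, hts, htne, fun v => ?_⟩
  rw [← ZMod.natCast_eq_zero_iff]
  simpa using congrFun ht v
end

section
/- Theorem of Shirazi and Verstraëte: Let G = (V, E) be a finite graph and for every vertex v ∈ V let F(v) ⊆ ℕ be a finite set of forbidden degrees with 0 ∉ F(v). If Σ_{v∈V} |F(v)| < |E|, then there exists a nonempty subset E' ⊆ E such that for every vertex v ∈ V, the number of edges of E' incident to v is not in F(v). -/
open MvPolynomial in
theorem MvPolynomial.coeff_prod_one_sub_X {σ R : Type*} [CommRing R] [Fintype σ] :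
    coeff (∑ i, Finsupp.single i 1) (∏ i : σ, (1 - X i : MvPolynomial σ R)) =
      (-1) ^ Fintype.card σ := by
  classical
  have hX (t : Finset σ) : ∏ i ∈ t, (X i : MvPolynomial σ R) =
      monomial (∑ i ∈ t, Finsupp.single i 1) 1 := by
    rw [monomial_sum_one]
    rfl
  have hne (t : Finset σ) (ht : t ≠ Finset.univ) :
      ∑ i ∈ t, Finsupp.single i 1 ≠ ∑ i : σ, Finsupp.single i 1 := by
    obtain ⟨j, hj⟩ : ∃ j, j ∉ t := by simpa [Finset.eq_univ_iff_forall] using ht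
    intro h
    simpa [Finsupp.finsetSum_apply, Finsupp.single_apply, hj] using DFunLike.congr_fun h j
  simp_rw [sub_eq_add_neg, Finset.prod_one_add, Finset.prod_neg, hX]
  have hcoeff (t : Finset σ) (m : σ →₀ ℕ) :
      coeff m ((-1) ^ t.card * monomial (∑ i ∈ t, Finsupp.single i 1) 1 : MvPolynomial σ R) =
        (-1) ^ t.card * coeff m (monomial (∑ i ∈ t, Finsupp.single i 1) 1) := by
    rw [← coeff_C_mul]
    simp
  rw [coeff_sum, Finset.sum_eq_single Finset.univ]
  · rw [hcoeff, coeff_monomial, if_pos rfl, mul_one, Finset.card_univ]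
  · intro t _ ht
    rw [hcoeff, coeff_monomial, if_neg (hne t ht), mul_zero]
  · simp

open MvPolynomial in
/-- A polynomial whose degree is less than the number of variables and which does not vanish at
the origin does not vanish at some other vertex of the cube `{0, 1}^σ`. -/
theorem MvPolynomial.exists_ne_zero_eval_ne_zero_of_totalDegree_lt_card
    {σ R : Type*} [CommRing R] [IsDomain R] [Fintype σ] (P : MvPolynomial σ R)
    (hdeg : P.totalDegree < Fintype.card σ) (hP : eval 0 P ≠ 0) :
    ∃ s : σ → R, s ≠ 0 ∧ (∀ i, s i = 0 ∨ s i = 1) ∧ eval s P ≠ 0 := by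
  classical
  let m : σ →₀ ℕ := ∑ i, Finsupp.single i 1
  have hm (i : σ) : m i = 1 := by
    simp [m, Finsupp.finsetSum_apply, Finsupp.single_apply]
  have hm_deg : m.degree = Fintype.card σ := by
    simp [Finsupp.degree_eq_sum, hm]
  let Q : MvPolynomial σ R := ∏ i, (1 - X i)
  let f := P - C (eval 0 P) * Q
  have hQ_deg : Q.totalDegree ≤ Fintype.card σ := by
    refine (totalDegree_finsetProd _ _).trans ?_
    refine (Finset.sum_le_card_nsmul _ _ 1 fun i _ => ?_).trans_eq (by simp)
    exact (totalDegree_sub _ _).trans (by simp)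
  have hf_coeff : coeff m f ≠ 0 := by
    have hPm : coeff m P = 0 := coeff_eq_zero_of_totalDegree_lt (by
      rwa [← Finsupp.degree_apply, hm_deg])
    simp only [f, coeff_sub, hPm, coeff_C_mul, Q, m, coeff_prod_one_sub_X]
    simpa using hP
  have hf_deg : f.totalDegree = m.degree := by
    refine le_antisymm ?_ (le_totalDegree (mem_support_iff.mpr hf_coeff))
    rw [hm_deg]
    refine (totalDegree_sub _ _).trans (max_le hdeg.le ?_)
    exact (totalDegree_mul _ _).trans (by simpa using hQ_deg)
  obtain ⟨s, hs, hsf⟩ := combinatorial_nullstellensatz_exists_eval_nonzero f m hf_coeff hf_deg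
    (fun _ => {0, 1}) (fun i => by simp [hm])
  have hs01 (i : σ) : s i = 0 ∨ s i = 1 := by simpa using hs i
  have hs0 : s ≠ 0 := by
    rintro rfl
    simp [f, Q] at hsf
  refine ⟨s, hs0, hs01, ?_⟩
  obtain ⟨j, hj⟩ := Function.ne_iff.mp hs0
  have hQs : eval s Q = 0 := by
    rw [eval_prod]
    exact Finset.prod_eq_zero (Finset.mem_univ j) (by simp [(hs01 j).resolve_left hj])
  simpa [f, hQs] using hsf

/-- **Theorem of Shirazi and Verstraëte.** Let `G = (V, E)` be a finite graph
and for each vertex `v` let `F v ⊆ ℕ` be a finite set of forbidden degrees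
with `0 ∉ F v`. If `Σ_v |F v| < |E|`, then there is a nonempty set `E'` of
edges such that for every vertex `v`, the number of edges of `E'` incident to
`v` is not in `F v`. -/
theorem shirazi_verstraete
    {V : Type*} [Fintype V] [DecidableEq V]
    (G : SimpleGraph V) [DecidableRel G.Adj]
    (F : V → Finset ℕ) (hF0 : ∀ v, 0 ∉ F v)
    (hm : ∑ v, (F v).card < G.edgeFinset.card) :
    ∃ E' ⊆ G.edgeFinset, E'.Nonempty ∧
      ∀ v : V, (E'.filter fun e => v ∈ e).card ∉ F v := by
  let L (v : V) : MvPolynomial G.edgeFinset ℚ := ∑ e with v ∈ e.1, MvPolynomial.X e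
  let P := ∏ v, ∏ c ∈ F v, (L v - MvPolynomial.C (c : ℚ))
  have hL (v : V) : (L v).totalDegree ≤ 1 :=
    MvPolynomial.totalDegree_finsetSum_le fun e _ => by simp
  have hP_deg : P.totalDegree ≤ ∑ v, (F v).card := by
    refine (MvPolynomial.totalDegree_finsetProd _ _).trans (Finset.sum_le_sum fun v _ => ?_)
    refine (MvPolynomial.totalDegree_finsetProd _ _).trans ?_
    refine (Finset.sum_le_card_nsmul _ _ 1 fun c _ => ?_).trans_eq (by simp)
    exact (MvPolynomial.totalDegree_sub_C_le _ _).trans (hL v)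
  have hP0 : MvPolynomial.eval 0 P ≠ 0 := by
    simp only [P, L, MvPolynomial.eval_prod, Finset.prod_ne_zero_iff]
    intro v _ c hc
    have hc0 : c ≠ 0 := fun h => hF0 v (h ▸ hc)
    simpa using hc0
  obtain ⟨s, hs0, hs01, hsP⟩ :=
    MvPolynomial.exists_ne_zero_eval_ne_zero_of_totalDegree_lt_card P
      (hP_deg.trans_lt (by simpa only [Fintype.card_coe] using hm)) hP0
  obtain ⟨j, hj⟩ := Function.ne_iff.mp hs0
  let T : Finset G.edgeFinset := {e | s e = 1}
  refine ⟨T.map (Function.Embedding.subtype _), ?_, ?_, ?_⟩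
  · intro e he
    obtain ⟨e', -, rfl⟩ := Finset.mem_map.mp he
    exact e'.2
  · exact Finset.Nonempty.map ⟨j, by simpa [T] using (hs01 j).resolve_left hj⟩
  · intro v hv
    have hLs : MvPolynomial.eval s (L v) =
        (((T.map (Function.Embedding.subtype _)).filter fun e => v ∈ e).card : ℚ) := by
      have hs (e : G.edgeFinset) : s e = if s e = 1 then 1 else 0 := by
        rcases hs01 e with h | h <;> simp [h]
      rw [Finset.filter_map, Finset.card_map, map_sum]
      simp only [MvPolynomial.eval_X]
      rw [Finset.sum_congr rfl fun e _ => hs e, Finset.sum_boole, Finset.filter_comm]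
      rfl
    simp only [P, MvPolynomial.eval_prod, Finset.prod_ne_zero_iff] at hsP
    exact hsP v (Finset.mem_univ v) _ hv (by simp [hLs])
end

section
/- Let p be a prime and d ≥ 1. Let G = (V, E) be a finite graph and for every vertex v ∈ V let F(v) ⊆ ℤ/p^dℤ be a set of forbidden residues with 0 ∉ F(v). If Σ_{v∈V} price(F(v)) < |E|, then there exists a nonempty subset E' ⊆ E such that for every vertex v ∈ V, the residue modulo p^d of the number of edges of E' incident to v is not in F(v). -/
open Polynomial in
/-- The integer-valued polynomial `x ↦ (x - 1).choose k` takes the values of `Ring.choose`. -/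
theorem eval_choose_comp_sub_one (k : ℕ) (t : ℤ) :
    eval (t : ℚ) (C ((k.factorial : ℚ)⁻¹) * (descPochhammer ℚ k).comp (X - 1)) =
      ((Ring.choose (t - 1) k : ℤ) : ℚ) := by
  have h1 := Ring.descPochhammer_eq_factorial_smul_choose (t - 1) k
  have h2 : eval ((t : ℚ) - 1) (descPochhammer ℚ k) =
      (((k.factorial : ℤ) * Ring.choose (t - 1) k : ℤ) : ℚ) := by
    rw [← nsmul_eq_mul, ← h1, ← descPochhammer_map (Int.castRingHom ℚ), eval_map,
      ← Polynomial.aeval_eq_smeval]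
    have := Polynomial.hom_eval₂ (descPochhammer ℤ k) (RingHom.id ℤ) (Int.castRingHom ℚ) (t - 1)
    simpa [Polynomial.aeval_def] using this.symm
  have hk : (k.factorial : ℚ) ≠ 0 := by exact_mod_cast k.factorial_ne_zero
  simp only [eval_mul, eval_C, eval_comp, eval_sub, eval_X, eval_one]
  rw [h2]
  push_cast
  field_simp

/-- If `p ^ d ∤ b`, then `p` divides `(b - 1).choose (p ^ d - 1)`. -/
theorem prime_dvd_choose_sub_one {p d : ℕ} (hp : p.Prime) {b : ℤ} (hb : ¬ ((p : ℤ) ^ d ∣ b)) :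
    (p : ℤ) ∣ Ring.choose (b - 1) (p ^ d - 1) := by
  have hpos : 0 < p ^ d := pow_pos hp.pos d
  obtain ⟨k, hk⟩ : ∃ k, p ^ d = k + 1 := ⟨p ^ d - 1, by omega⟩
  have key : ((p : ℤ) ^ d) * Ring.choose b (p ^ d) = b * Ring.choose (b - 1) (p ^ d - 1) := by
    have h := eval_choose_comp_sub_one (k + 1) (b + 1)
    have h' := eval_choose_comp_sub_one k b
    have hd : descPochhammer ℚ (k + 1) =
        Polynomial.X * (descPochhammer ℚ k).comp (Polynomial.X - 1) := by
      rw [descPochhammer_succ_left]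
    have hpq : ((p : ℤ) ^ d) = (k : ℤ) + 1 := by exact_mod_cast hk
    rw [hpq, hk, Nat.add_sub_cancel]
    have hq : ((((k : ℤ) + 1) * Ring.choose b (k + 1) : ℤ) : ℚ) =
        ((b * Ring.choose (b - 1) k : ℤ) : ℚ) := by
      rw [add_sub_cancel_right] at h
      push_cast
      rw [← h, ← h', hd]
      have hf : (k.factorial : ℚ) ≠ 0 := by exact_mod_cast k.factorial_ne_zero
      simp [Nat.factorial_succ]
      have : (k : ℚ) + 1 ≠ 0 := by positivity
      field_simp
    exact_mod_cast hq
  by_contra hnd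
  apply hb
  have hcop : IsCoprime ((p : ℤ) ^ d) (Ring.choose (b - 1) (p ^ d - 1)) :=
    ((Nat.prime_iff_prime_int.mp hp).coprime_iff_not_dvd.mpr hnd).pow_left
  exact hcop.dvd_of_dvd_mul_right ⟨_, key.symm⟩

/-- Every set of nonzero residues modulo `p ^ d` has a covering set. -/
theorem exists_coversSet {p d : ℕ} (hp : p.Prime) {B : Set (ZMod (p ^ d))}
    (hB : (0 : ZMod (p ^ d)) ∉ B) : ∃ H, CoversSet p d H B := by
  refine ⟨{Polynomial.C (((p ^ d - 1).factorial : ℚ)⁻¹) *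
    (descPochhammer ℚ (p ^ d - 1)).comp (Polynomial.X - 1)}, ?_, ?_, ?_⟩
  · intro h hh t
    rw [Finset.mem_singleton] at hh
    exact ⟨_, hh ▸ eval_choose_comp_sub_one _ t⟩
  · intro h hh z hz hpz
    rw [Finset.mem_singleton] at hh
    have h0 := eval_choose_comp_sub_one (p ^ d - 1) 0
    rw [Int.cast_zero, ← hh, hz, Int.cast_inj, zero_sub, Ring.choose_neg'] at h0
    rw [Ring.multichoose_one] at h0
    have hu : IsUnit z := by
      rw [h0]
      simp
    exact (Nat.prime_iff_prime_int.mp hp).not_isUnit (isUnit_of_dvd_unit hpz hu)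
  · intro b hb
    refine ⟨_, Finset.mem_singleton_self _, _, eval_choose_comp_sub_one _ b,
      prime_dvd_choose_sub_one hp fun hdvd => hB ?_⟩
    have : (b : ZMod (p ^ d)) = 0 := by
      rw [ZMod.intCast_zmod_eq_zero_iff_dvd]
      exact_mod_cast hdvd
    rwa [this] at hb

/-- The price of a set of nonzero residues is attained by a covering set. -/
theorem exists_coversSet_price {p d : ℕ} (hp : p.Prime) {B : Set (ZMod (p ^ d))}
    (hB : (0 : ZMod (p ^ d)) ∉ B) :
    ∃ H, CoversSet p d H B ∧ price p d B = ∑ h ∈ H, h.natDegree := by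
  obtain ⟨H, hH⟩ := exists_coversSet hp hB
  exact Nat.sInf_mem (s := {s : ℕ | ∃ H : Finset (Polynomial ℚ),
    CoversSet p d H B ∧ s = ∑ h ∈ H, h.natDegree}) ⟨_, H, hH, rfl⟩

/-- The alternating sum over the subcube `{0, 1}^s` of a polynomial of degree less than `#s`
vanishes. -/
theorem sum_powerset_neg_one_pow_card_mul_eval_eq_zero {σ R : Type*} [DecidableEq σ] [CommRing R]
    (s : Finset σ) (P : MvPolynomial σ R) (hP : P.totalDegree < s.card) :
    ∑ S ∈ s.powerset, (-1 : R) ^ S.card *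
      MvPolynomial.eval (fun i => if i ∈ S then (1 : R) else 0) P = 0 := by
  simp only [MvPolynomial.eval_eq, Finset.mul_sum]
  rw [Finset.sum_comm]
  refine Finset.sum_eq_zero fun m hm => ?_
  obtain ⟨e, he, hme⟩ : ∃ e ∈ s, m e = 0 := by
    by_contra! hne
    have h1 : s.card ≤ m.support.card :=
      Finset.card_le_card fun i hi => Finsupp.mem_support_iff.mpr (hne i hi)
    have h2 : m.support.card ≤ ∑ i ∈ m.support, m i := by
      rw [Finset.card_eq_sum_ones]
      exact Finset.sum_le_sum fun i hi => Nat.one_le_iff_ne_zero.mpr (Finsupp.mem_support_iff.mp hi)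
    have h3 : ∑ i ∈ m.support, m i ≤ P.totalDegree := MvPolynomial.le_totalDegree hm
    omega
  rw [← Finset.insert_erase he, Finset.sum_powerset_insert (Finset.notMem_erase e s),
    ← Finset.sum_add_distrib]
  refine Finset.sum_eq_zero fun S hS => ?_
  have heS : e ∉ S := fun h => Finset.notMem_erase e s (Finset.mem_powerset.mp hS h)
  have hprod : ∏ i ∈ m.support, (if i ∈ insert e S then (1 : R) else 0) ^ m i =
      ∏ i ∈ m.support, (if i ∈ S then (1 : R) else 0) ^ m i := by
    refine Finset.prod_congr rfl fun i hi => ?_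
    have hie : i ≠ e := fun h => Finsupp.mem_support_iff.mp hi (h ▸ hme)
    simp [hie]
  rw [hprod, Finset.card_insert_of_notMem heS]
  ring

/-- Substituting a polynomial of degree at most one does not increase the degree. -/
theorem totalDegree_aeval_le_natDegree {σ R : Type*} [CommRing R] (h : Polynomial R)
    {D : MvPolynomial σ R} (hD : D.totalDegree ≤ 1) :
    (Polynomial.aeval D h).totalDegree ≤ h.natDegree := by
  rw [Polynomial.aeval_eq_sum_range]
  refine MvPolynomial.totalDegree_finsetSum_le fun i hi => ?_
  refine (MvPolynomial.totalDegree_smul_le _ _).trans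
    ((MvPolynomial.totalDegree_pow _ _).trans ?_)
  have : i ≤ h.natDegree := Nat.lt_succ_iff.mp (Finset.mem_range.mp hi)
  nlinarith

/-- **Degree-constrained subgraphs modulo prime powers.** Let `G = (V, E)` be
a finite graph and for each vertex `v` let `F v ⊆ ℤ/p^dℤ` be a set of
forbidden residues with `0 ∉ F v`. If `Σ_v price(F v) < |E|`, then there is a
nonempty set `E'` of edges such that for every vertex `v`, the residue modulo
`p ^ d` of the number of edges of `E'` incident to `v` is not in `F v`. -/
theorem degree_constrained_subgraph_mod_prime_power
    (p d : ℕ) (hp : p.Prime) (hd : 1 ≤ d)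
    {V : Type*} [Fintype V] [DecidableEq V]
    (G : SimpleGraph V) [DecidableRel G.Adj]
    (F : V → Set (ZMod (p ^ d))) (hF0 : ∀ v, (0 : ZMod (p ^ d)) ∉ F v)
    (hm : ∑ v, price p d (F v) < G.edgeFinset.card) :
    ∃ E' ⊆ G.edgeFinset, E'.Nonempty ∧
      ∀ v : V, (((E'.filter fun e => v ∈ e).card : ℕ) : ZMod (p ^ d)) ∉ F v := by
  choose H hH hprice using fun v => exists_coversSet_price hp (hF0 v)
  by_contra! hcon
  let D : V → MvPolynomial (Sym2 V) ℚ := fun v =>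
    ∑ e ∈ G.edgeFinset.filter (fun e => v ∈ e), MvPolynomial.X e
  let P : MvPolynomial (Sym2 V) ℚ := ∏ v, ∏ h ∈ H v, Polynomial.aeval (D v) h
  have hD : ∀ v, (D v).totalDegree ≤ 1 := fun v =>
    MvPolynomial.totalDegree_finsetSum_le fun e _ => (MvPolynomial.totalDegree_X e).le
  have hP : P.totalDegree < G.edgeFinset.card := by
    refine lt_of_le_of_lt ?_ hm
    refine (MvPolynomial.totalDegree_finsetProd _ _).trans (Finset.sum_le_sum fun v _ => ?_)
    rw [hprice v]
    exact (MvPolynomial.totalDegree_finsetProd _ _).trans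
      (Finset.sum_le_sum fun h _ => totalDegree_aeval_le_natDegree h (hD v))
  have hsum := sum_powerset_neg_one_pow_card_mul_eval_eq_zero _ P hP
  choose! val hval using fun v => (hH v).1
  have hPeval : ∀ S ∈ G.edgeFinset.powerset,
      MvPolynomial.eval (fun i => if i ∈ S then (1 : ℚ) else 0) P =
        ((∏ v, ∏ h ∈ H v, val v h ((S.filter fun e => v ∈ e).card : ℕ) : ℤ) : ℚ) := by
    intro S hS
    have hDeval : ∀ v, MvPolynomial.eval (fun i => if i ∈ S then (1 : ℚ) else 0) (D v) =
        (((S.filter fun e => v ∈ e).card : ℕ) : ℚ) := by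
      intro v
      have hfilter : (G.edgeFinset.filter fun e => v ∈ e).filter (fun e => e ∈ S) =
          S.filter fun e => v ∈ e := by
        ext e
        simp only [Finset.mem_filter]
        exact ⟨fun h => ⟨h.2, h.1.2⟩, fun h => ⟨⟨Finset.mem_powerset.mp hS h.1, h.2⟩, h.1⟩⟩
      simp only [D, map_sum, MvPolynomial.eval_X]
      rw [Finset.sum_boole, hfilter]
    simp only [P, map_prod]
    push_cast
    refine Finset.prod_congr rfl fun v _ => Finset.prod_congr rfl fun h hh => ?_
    rw [← hval v h hh, Int.cast_natCast, ← hDeval v]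
    have := Polynomial.hom_eval₂ h (algebraMap ℚ (MvPolynomial (Sym2 V) ℚ))
      (MvPolynomial.eval fun i => if i ∈ S then (1 : ℚ) else 0) (D v)
    rw [Polynomial.aeval_def, this, ← Polynomial.eval₂_id]
    congr 1
    exact Subsingleton.elim _ _
  rw [Finset.sum_congr rfl fun S hS => by rw [hPeval S hS]] at hsum
  have hint : ∑ S ∈ G.edgeFinset.powerset, (-1 : ℤ) ^ S.card *
      ∏ v, ∏ h ∈ H v, val v h ((S.filter fun e => v ∈ e).card : ℕ) = 0 := by
    exact_mod_cast hsum
  rw [← Finset.add_sum_erase _ _ (Finset.empty_mem_powerset G.edgeFinset)] at hint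
  have hrest : (p : ℤ) ∣ ∑ S ∈ G.edgeFinset.powerset.erase ∅, (-1 : ℤ) ^ S.card *
      ∏ v, ∏ h ∈ H v, val v h ((S.filter fun e => v ∈ e).card : ℕ) := by
    refine Finset.dvd_sum fun S hS => Dvd.dvd.mul_left ?_ _
    obtain ⟨hne, hS⟩ := Finset.mem_erase.mp hS
    obtain ⟨v, hv⟩ := hcon S (Finset.mem_powerset.mp hS) (Finset.nonempty_iff_ne_empty.mpr hne)
    obtain ⟨h, hh, z, hz, hpz⟩ := (hH v).2.2 ((S.filter fun e => v ∈ e).card : ℕ)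
      (by simpa using hv)
    rw [hval v h hh, Int.cast_inj] at hz
    rw [← hz] at hpz
    exact (hpz.trans (Finset.dvd_prod_of_mem
        (fun h => val v h ((S.filter fun e => v ∈ e).card : ℕ)) hh)).trans
      (Finset.dvd_prod_of_mem (fun v => ∏ h ∈ H v, val v h ((S.filter fun e => v ∈ e).card : ℕ))
        (Finset.mem_univ v))
  have hempty := (dvd_add_left hrest).mp (hint ▸ dvd_zero (p : ℤ))
  simp only [Finset.card_empty, pow_zero, one_mul, Finset.filter_empty, Nat.cast_zero] at hempty
  have hprime := Nat.prime_iff_prime_int.mp hp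
  obtain ⟨v, _, hv⟩ := hprime.exists_mem_finset_dvd hempty
  obtain ⟨h, hh, hdvd⟩ := hprime.exists_mem_finset_dvd hv
  exact (hH v).2.1 h hh _ (by simpa using hval v h hh 0) hdvd
end
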